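/- arXiv:1606.01212 — 2 statements merged into one kernel-verified Lean document; each statement's English description precedes it below -/
import Mathlib

section
/- Let n ≥ 3 be an integer and 0 < D < π. Then λ̄₂(n,D) − λ̄₁(n,D) ≥ 3π²/D². -/
open Real Set

noncomputable section

/-- Rayleigh quotient of the one-dimensional model operator
`d²/ds² − (n−1)·tan(s)·d/ds` on `[−D/2, D/2]` with weight `cos^{n−1}(s)`. -/
def rayleighQ (n : ℕ) (D : ℝ) (φ : ℝ → ℝ) : ℝ :=
  (∫ s in (-(D/2))..(D/2), deriv φ s ^ 2 * Real.cos s ^ (n-1)) /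
  (∫ s in (-(D/2))..(D/2), φ s ^ 2 * Real.cos s ^ (n-1))

/-- The first model eigenvalue `λ̄₁(n,D)`: infimum of the Rayleigh quotient over
nonzero C¹ functions on `[−D/2, D/2]` vanishing at the endpoints. -/
def modelLam1 (n : ℕ) (D : ℝ) : ℝ :=
  sInf (rayleighQ n D '' {φ : ℝ → ℝ | ContDiffOn ℝ 1 φ (Set.Icc (-(D/2)) (D/2)) ∧
    (∃ s ∈ Set.Icc (-(D/2)) (D/2), φ s ≠ 0) ∧ φ (-(D/2)) = 0 ∧ φ (D/2) = 0})

/-- The second model eigenvalue `λ̄₂(n,D)`: the same infimum restricted to odd functions. -/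
def modelLam2 (n : ℕ) (D : ℝ) : ℝ :=
  sInf (rayleighQ n D '' {φ : ℝ → ℝ | ContDiffOn ℝ 1 φ (Set.Icc (-(D/2)) (D/2)) ∧
    (∃ s ∈ Set.Icc (-(D/2)) (D/2), φ s ≠ 0) ∧
    (∀ s ∈ Set.Icc (-(D/2)) (D/2), φ (-s) = -φ s) ∧ φ (-(D/2)) = 0 ∧ φ (D/2) = 0})

open Filter Topology

/-- Absolute convergence of the power series with coefficients `a` on the open unit disc. -/
def UnitSummable (a : ℕ → ℝ) : Prop :=
  ∀ r : ℝ, 0 < r → r < 1 → Summable fun j => |a j| * r ^ j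

theorem UnitSummable.derivCoeff {a : ℕ → ℝ} (ha : UnitSummable a) :
    UnitSummable fun j => (j + 1 : ℝ) * a (j + 1) := by
  intro r hr0 hr1
  obtain ⟨s, hrs, hs1⟩ := exists_between hr1
  have hs0 : 0 < s := hr0.trans hrs
  have hb := (ha s hs0 hs1).tendsto_atTop_zero.bddAbove_range
  obtain ⟨C, hC⟩ := hb
  have hC' : ∀ j, |a j| * s ^ j ≤ C := fun j => hC ⟨j, rfl⟩
  have hq : ‖r / s‖ < 1 := by
    rw [Real.norm_of_nonneg (by positivity), div_lt_one hs0]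
    exact hrs
  have h1 := summable_pow_mul_geometric_of_norm_lt_one 1 hq
  have h0 := summable_geometric_of_norm_lt_one hq
  refine Summable.of_nonneg_of_le (fun j => by positivity) (fun j => ?_)
    ((h1.add h0).mul_left (C / s))
  have h2 : |(j + 1 : ℝ) * a (j + 1)| = (j + 1) * |a (j + 1)| := by
    rw [abs_mul, abs_of_nonneg (by positivity)]
  have h3 : (j + 1 : ℝ) * |a (j + 1)| * r ^ j
      = (|a (j + 1)| * s ^ (j + 1)) / s * ((j + 1) * (r / s) ^ j) := by
    rw [div_pow, pow_succ]
    field_simp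
  rw [h2, h3]
  have h4 : C / s * ((j : ℝ) ^ 1 * (r / s) ^ j + (r / s) ^ j)
      = C / s * ((j + 1) * (r / s) ^ j) := by ring
  rw [h4]
  gcongr
  exact hC' (j + 1)

theorem UnitSummable.summable {a : ℕ → ℝ} (ha : UnitSummable a) {z : ℝ} (hz : |z| < 1) :
    Summable fun j => a j * z ^ j := by
  obtain ⟨r, hr, hr1⟩ := exists_between hz
  refine Summable.of_norm_bounded (ha r ((abs_nonneg z).trans_lt hr) hr1) fun j => ?_
  rw [norm_mul, norm_pow, Real.norm_eq_abs, Real.norm_eq_abs]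
  gcongr

theorem UnitSummable.hasDerivAt {a : ℕ → ℝ} (ha : UnitSummable a) {z : ℝ} (hz : |z| < 1) :
    HasDerivAt (fun z => ∑' j, a j * z ^ j)
      (∑' j : ℕ, ((j + 1 : ℝ) * a (j + 1)) * z ^ j) z := by
  obtain ⟨r, hr, hr1⟩ := exists_between hz
  have hr0 : 0 < r := (abs_nonneg z).trans_lt hr
  have hmem : ∀ y, y ∈ Metric.ball (0 : ℝ) r → |y| < r := fun y hy => by simpa using hy
  have hd := ha.derivCoeff
  have hu : Summable fun j : ℕ => |(j : ℝ) * a j| * r ^ (j - 1) := by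
    rw [← summable_nat_add_iff 1]
    simpa using hd r hr0 hr1
  have hmain := hasDerivAt_tsum_of_isPreconnected (𝕜 := ℝ) (g := fun j y => a j * y ^ j)
    (g' := fun j y => ((j : ℝ) * a j) * y ^ (j - 1)) (t := Metric.ball (0 : ℝ) r)
    (y := z) (y₀ := z)
    hu Metric.isOpen_ball (convex_ball 0 r).isPreconnected
    (fun j y _ => by
      have := (hasDerivAt_pow j y).const_mul (a j)
      convert! this using 1
      ring)
    (fun j y hy => by
      rw [norm_mul, norm_pow, Real.norm_eq_abs, Real.norm_eq_abs]
      have := (hmem y hy).le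
      gcongr)
    (by simpa using hr) (ha.summable hz) (by simpa using hr)
  convert! hmain using 1
  have hs : Summable fun j : ℕ => ((j : ℝ) * a j) * z ^ (j - 1) := by
    rw [← summable_nat_add_iff 1]
    simpa using hd.summable hz
  rw [hs.tsum_eq_zero_add]
  simp

theorem UnitSummable.contDiffOn {a : ℕ → ℝ} (ha : UnitSummable a) (k : ℕ) :
    ContDiffOn ℝ k (fun z => ∑' j, a j * z ^ j) (Ioo (-1) 1) := by
  induction k generalizing a with
  | zero =>
    rw [Nat.cast_zero, contDiffOn_zero]
    exact fun z hz => (ha.hasDerivAt (abs_lt.2 hz)).continuousAt.continuousWithinAt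
  | succ k ih =>
    rw [Nat.cast_succ, contDiffOn_succ_iff_deriv_of_isOpen isOpen_Ioo]
    refine ⟨fun z hz => (ha.hasDerivAt (abs_lt.2 hz)).differentiableAt.differentiableWithinAt,
      by simp, (ih ha.derivCoeff).congr fun z hz => (ha.hasDerivAt (abs_lt.2 hz)).deriv⟩

/-- Taylor coefficients in `z = sin² s` of `φ(s) / sin s`, where `φ` is the odd solution of
`φ'' - (n - 1) tan(s) φ' + l φ = 0` with `φ'(0) = 1`. -/
def oddCoeff (n : ℕ) (l : ℝ) : ℕ → ℝ
  | 0 => 1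
  | j + 1 => ((2 * j + 1) * (2 * j + n) - l) / ((2 * j + 3) * (2 * j + 2)) * oddCoeff n l j

theorem oddCoeff_zero (n : ℕ) (l : ℝ) : oddCoeff n l 0 = 1 := rfl

theorem oddCoeff_succ (n : ℕ) (l : ℝ) (j : ℕ) : oddCoeff n l (j + 1) =
    ((2 * j + 1) * (2 * j + n) - l) / ((2 * j + 3) * (2 * j + 2)) * oddCoeff n l j := rfl

theorem oddCoeff_neg_pos {n : ℕ} (hn : 1 ≤ n) {L : ℝ} (hL : 0 ≤ L) (j : ℕ) :
    0 < oddCoeff n (-L) j := by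
  induction j with
  | zero => simp [oddCoeff_zero]
  | succ j ih =>
    rw [oddCoeff_succ]
    have : (1 : ℝ) ≤ n := by exact_mod_cast hn
    have : 0 < (2 * (j : ℝ) + 1) * (2 * j + n) - -L := by
      have : 0 < (2 * (j : ℝ) + 1) * (2 * j + n) := by positivity
      linarith
    positivity

theorem abs_oddCoeff_le (n : ℕ) {l L : ℝ} (hl : |l| ≤ L) (j : ℕ) :
    |oddCoeff n l j| ≤ oddCoeff n (-L) j := by
  induction j with
  | zero => simp [oddCoeff_zero]
  | succ j ih =>
    rw [oddCoeff_succ, oddCoeff_succ, abs_mul, abs_div,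
      abs_of_pos (show (0 : ℝ) < (2 * j + 3) * (2 * j + 2) by positivity)]
    have h0 : (0 : ℝ) ≤ (2 * j + 1) * (2 * j + n) := by positivity
    have : |(2 * (j : ℝ) + 1) * (2 * j + n) - l| ≤ (2 * j + 1) * (2 * j + n) - -L := by
      obtain ⟨h1, h2⟩ := abs_le.1 hl
      rw [abs_le]
      constructor <;> linarith
    gcongr
    exact div_nonneg ((abs_nonneg _).trans this) (by positivity)

theorem summable_oddCoeff_neg {n : ℕ} (hn : 1 ≤ n) {L : ℝ} (hL : 0 ≤ L) {r : ℝ} (hr0 : 0 < r)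
    (hr1 : r < 1) : Summable fun j => oddCoeff n (-L) j * r ^ j := by
  have hpos := oddCoeff_neg_pos hn hL
  refine summable_of_ratio_test_tendsto_lt_one hr1
    (Eventually.of_forall fun j => (mul_pos (hpos j) (pow_pos hr0 j)).ne') ?_
  have hlim : Tendsto (fun x : ℝ => ((2 + x) * (2 + n * x) + L * x ^ 2) / ((2 + 3 * x) * (2 + 2 * x)) * r)
      (𝓝 0) (𝓝 r) := by
    have hc : ContinuousAt (fun x : ℝ =>
        ((2 + x) * (2 + n * x) + L * x ^ 2) / ((2 + 3 * x) * (2 + 2 * x)) * r) 0 := by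
      refine ContinuousAt.mul (ContinuousAt.div ?_ ?_ ?_) continuousAt_const
      · fun_prop
      · fun_prop
      · norm_num
    simpa using hc.tendsto
  refine (hlim.comp tendsto_inv_atTop_nhds_zero_nat).congr' ?_
  filter_upwards [eventually_gt_atTop 0] with j hj
  have hj' : (0 : ℝ) < j := by exact_mod_cast hj
  rw [Real.norm_of_nonneg (mul_pos (hpos _) (pow_pos hr0 _)).le,
    Real.norm_of_nonneg (mul_pos (hpos _) (pow_pos hr0 _)).le, oddCoeff_succ, Function.comp_apply]
  have := (hpos j).ne'
  field_simp
  ring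

theorem unitSummable_oddCoeff {n : ℕ} (hn : 1 ≤ n) (l : ℝ) : UnitSummable (oddCoeff n l) := by
  intro r hr0 hr1
  refine Summable.of_nonneg_of_le (fun j => by positivity) (fun j => ?_)
    (summable_oddCoeff_neg hn (abs_nonneg l) hr0 hr1)
  gcongr
  exact abs_oddCoeff_le n le_rfl j

/-- The even factor `φ(s) / sin s` of the odd solution, as a function of `z = sin² s`. -/
def oddSeries (n : ℕ) (l z : ℝ) : ℝ := ∑' j, oddCoeff n l j * z ^ j

theorem oddSeries_zero (n : ℕ) (l : ℝ) : oddSeries n l 0 = 1 := by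
  rw [oddSeries, tsum_eq_single 0]
  · simp [oddCoeff_zero]
  · intro j hj
    simp [hj]

theorem continuous_oddCoeff (n j : ℕ) : Continuous fun l => oddCoeff n l j := by
  induction j with
  | zero => simp only [oddCoeff_zero]; fun_prop
  | succ j ih => simp only [oddCoeff_succ]; fun_prop

theorem continuousAt_oddSeries {n : ℕ} (hn : 1 ≤ n) (l : ℝ) {z : ℝ} (hz : |z| < 1) :
    ContinuousAt (fun p : ℝ × ℝ => oddSeries n p.1 p.2) (l, z) := by
  obtain ⟨r, hr, hr1⟩ := exists_between hz
  have hr0 : 0 < r := (abs_nonneg z).trans_lt hr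
  set U : Set (ℝ × ℝ) := {p | |p.1| < |l| + 1 ∧ |p.2| < r} with hU
  have hUo : IsOpen U := by
    apply IsOpen.inter
    · exact isOpen_lt (continuous_abs.comp continuous_fst) continuous_const
    · exact isOpen_lt (continuous_abs.comp continuous_snd) continuous_const
  have hL : 0 ≤ |l| + 1 := by positivity
  have : ContinuousOn (fun p : ℝ × ℝ => ∑' j, oddCoeff n p.1 j * p.2 ^ j) U := by
    refine continuousOn_tsum (fun j => ?_) (summable_oddCoeff_neg hn hL hr0 hr1)
      fun j p hp => ?_
    · have := continuous_oddCoeff n j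
      fun_prop
    · rw [norm_mul, norm_pow, Real.norm_eq_abs, Real.norm_eq_abs]
      have h1 := abs_oddCoeff_le n hp.1.le j
      have h2 := hp.2.le
      have := (oddCoeff_neg_pos hn hL j).le
      gcongr
  exact this.continuousAt (hUo.mem_nhds ⟨by simp, hr⟩)

theorem oddSeries_zero_pos {n : ℕ} (hn : 1 ≤ n) {z : ℝ} (hz0 : 0 ≤ z) (hz : z < 1) :
    0 < oddSeries n 0 z := by
  have hpos : ∀ j, 0 < oddCoeff n 0 j := by simpa using oddCoeff_neg_pos hn le_rfl
  have hs := (unitSummable_oddCoeff hn 0).summable (by rwa [abs_of_nonneg hz0])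
  exact hs.tsum_pos (fun j => mul_nonneg (hpos j).le (by positivity)) 0
    (by simp [oddCoeff_zero])

theorem oddSeries_ode {n : ℕ} (hn : 1 ≤ n) (l : ℝ) :
    ∃ H' H'' : ℝ → ℝ, ∀ z, |z| < 1 → HasDerivAt (oddSeries n l) (H' z) z ∧
      HasDerivAt H' (H'' z) z ∧
      4 * z * (1 - z) * H'' z + (6 - (6 + 2 * n) * z) * H' z + (l - n) * oddSeries n l z = 0 := by
  have ha := unitSummable_oddCoeff hn l
  refine ⟨_, _, fun z hz => ⟨ha.hasDerivAt hz, ha.derivCoeff.hasDerivAt hz, ?_⟩⟩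
  have s0 := (ha.summable hz).hasSum
  have s1 := (ha.derivCoeff.summable hz).hasSum
  have s2 := (ha.derivCoeff.derivCoeff.summable hz).hasSum
  rw [oddSeries]
  set A := ∑' j, oddCoeff n l j * z ^ j
  set B := ∑' j : ℕ, (j + 1 : ℝ) * oddCoeff n l (j + 1) * z ^ j
  set C := ∑' j : ℕ, (j + 1 : ℝ) * (((j + 1 : ℕ) + 1 : ℝ) * oddCoeff n l (j + 1 + 1)) * z ^ j
  have t1 : HasSum (fun j : ℕ => (j : ℝ) * oddCoeff n l j * z ^ j) (z * B) := by
    rw [← hasSum_nat_add_iff' 1]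
    convert! s1.mul_left z using 1
    · ext j; push_cast; ring
    · simp
  have t2 : HasSum (fun j : ℕ => (j : ℝ) * (j + 1) * oddCoeff n l (j + 1) * z ^ j) (z * C) := by
    rw [← hasSum_nat_add_iff' 1]
    convert! s2.mul_left z using 1
    · ext j; push_cast; ring
    · simp
  have t3 : HasSum (fun j : ℕ => (j : ℝ) * (j - 1) * oddCoeff n l j * z ^ j) (z * (z * C)) := by
    rw [← hasSum_nat_add_iff' 1]
    convert! t2.mul_left z using 1
    · ext j; push_cast; ring
    · simp
  have key := ((((t2.mul_left 4).sub (t3.mul_left 4)).add (s1.mul_left 6)).sub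
    (t1.mul_left (6 + 2 * (n : ℝ)))).add (s0.mul_left (l - n))
  have h0 : ∀ j : ℕ, 4 * ((j : ℝ) * (j + 1) * oddCoeff n l (j + 1) * z ^ j)
      - 4 * ((j : ℝ) * (j - 1) * oddCoeff n l j * z ^ j)
      + 6 * ((j + 1) * oddCoeff n l (j + 1) * z ^ j)
      - (6 + 2 * n) * ((j : ℝ) * oddCoeff n l j * z ^ j)
      + (l - n) * (oddCoeff n l j * z ^ j) = 0 := by
    intro j
    rw [oddCoeff_succ]
    field_simp
    ring
  simp only [h0] at key
  have := key.unique hasSum_zero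
  linear_combination this

theorem abs_sin_sq_lt_one {s : ℝ} (hs : s ∈ Ioo (-(π / 2)) (π / 2)) : |sin s ^ 2| < 1 := by
  rw [abs_of_nonneg (sq_nonneg _)]
  nlinarith [sin_sq_add_cos_sq s, pow_pos (cos_pos_of_mem_Ioo hs) 2]

/-- The even function `φ(s) / sin s`. -/
def evenPart (n : ℕ) (l s : ℝ) : ℝ := oddSeries n l (sin s ^ 2)

/-- The odd solution of `φ'' - (n - 1) tan(s) φ' + l φ = 0` with `φ'(0) = 1`. -/
def oddSol (n : ℕ) (l s : ℝ) : ℝ := sin s * evenPart n l s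

theorem evenPart_zero (n : ℕ) (l : ℝ) : evenPart n l 0 = 1 := by
  simp [evenPart, oddSeries_zero]

theorem oddSol_zero (n : ℕ) (l : ℝ) : oddSol n l 0 = 0 := by simp [oddSol]

theorem evenPart_neg (n : ℕ) (l s : ℝ) : evenPart n l (-s) = evenPart n l s := by
  simp [evenPart]

theorem contDiffOn_evenPart {n : ℕ} (hn : 1 ≤ n) (l : ℝ) (k : ℕ) :
    ContDiffOn ℝ k (evenPart n l) (Ioo (-(π / 2)) (π / 2)) := by
  have h := (unitSummable_oddCoeff hn l).contDiffOn k
  refine h.comp (t := Ioo (-1) 1) (f := fun s : ℝ => sin s ^ 2) ?_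
    fun s hs => abs_lt.1 (abs_sin_sq_lt_one hs)
  exact (contDiff_sin.pow 2).contDiffOn

theorem continuousAt_evenPart {n : ℕ} (hn : 1 ≤ n) (l : ℝ) {s : ℝ}
    (hs : s ∈ Ioo (-(π / 2)) (π / 2)) :
    ContinuousAt (fun p : ℝ × ℝ => evenPart n p.1 p.2) (l, s) := by
  have h := continuousAt_oddSeries hn l (abs_sin_sq_lt_one hs)
  exact ContinuousAt.comp (f := fun p : ℝ × ℝ => (p.1, sin p.2 ^ 2)) (x := (l, s)) h (by fun_prop)

/-- The eigenfunction equation for `φ` on `(-π/2, π/2)`, with `φ'` the derivative of `φ`. -/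
def SolvesModel (n : ℕ) (l : ℝ) (φ φ' : ℝ → ℝ) : Prop :=
  ∀ s ∈ Ioo (-(π / 2)) (π / 2),
    HasDerivAt φ (φ' s) s ∧ HasDerivAt φ' ((n - 1) * tan s * φ' s - l * φ s) s

theorem exists_solvesModel_oddSol {n : ℕ} (hn : 1 ≤ n) (l : ℝ) :
    ∃ φ', SolvesModel n l (oddSol n l) φ' := by
  obtain ⟨H', H'', hH⟩ := oddSeries_ode hn l
  refine ⟨fun s => cos s * oddSeries n l (sin s ^ 2) + 2 * sin s ^ 2 * cos s * H' (sin s ^ 2),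
    fun s hs => ?_⟩
  obtain ⟨h1, h2, h3⟩ := hH _ (abs_sin_sq_lt_one hs)
  have hc : cos s ≠ 0 := (cos_pos_of_mem_Ioo hs).ne'
  have hsq : HasDerivAt (fun s => sin s ^ 2) (2 * sin s * cos s) s := by
    simpa using (hasDerivAt_sin s).fun_pow 2
  have d1 : HasDerivAt (fun s => oddSeries n l (sin s ^ 2))
      (H' (sin s ^ 2) * (2 * sin s * cos s)) s := HasDerivAt.comp (h₂ := oddSeries n l) s h1 hsq
  have d2 : HasDerivAt (fun s => H' (sin s ^ 2))
      (H'' (sin s ^ 2) * (2 * sin s * cos s)) s := HasDerivAt.comp (h₂ := H') s h2 hsq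
  have hz : 1 - sin s ^ 2 = cos s ^ 2 := by linarith [sin_sq_add_cos_sq s]
  constructor
  · refine ((hasDerivAt_sin s).mul d1).congr_deriv ?_
    ring
  · refine (((hasDerivAt_cos s).mul d1).add
      (((hsq.const_mul 2).fun_mul (hasDerivAt_cos s)).fun_mul d2)).congr_deriv ?_
    rw [tan_eq_sin_div_cos, oddSol, evenPart]
    rw [hz] at h3
    have h4 : ((n : ℝ) - 1) * (sin s / cos s) * (cos s * oddSeries n l (sin s ^ 2)
        + 2 * sin s ^ 2 * cos s * H' (sin s ^ 2)) = ((n : ℝ) - 1) * sin s *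
        (oddSeries n l (sin s ^ 2) + 2 * sin s ^ 2 * H' (sin s ^ 2)) := by
      field_simp
    rw [h4]
    linear_combination (sin s) * h3 + 6 * sin s * H' (sin s ^ 2) * sin_sq_add_cos_sq s

theorem hasDerivAt_cos_pow_sub_one {n : ℕ} (hn : 1 ≤ n) {s : ℝ} (hs : cos s ≠ 0) :
    HasDerivAt (fun s => cos s ^ (n - 1)) (-((n - 1) * tan s * cos s ^ (n - 1))) s := by
  obtain ⟨k, rfl⟩ := Nat.exists_eq_add_of_le' hn
  refine ((hasDerivAt_cos s).pow _).congr_deriv ?_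
  rw [tan_eq_sin_div_cos]
  rcases k with _ | k
  · simp
  · simp only [Nat.add_sub_cancel]
    push_cast
    field_simp
    ring

theorem SolvesModel.hasDerivAt_wronskian {n : ℕ} (hn : 1 ≤ n) {l μ : ℝ} {φ φ' ψ ψ' : ℝ → ℝ}
    (hφ : SolvesModel n l φ φ') (hψ : SolvesModel n μ ψ ψ') {s : ℝ}
    (hs : s ∈ Ioo (-(π / 2)) (π / 2)) :
    HasDerivAt (fun s => cos s ^ (n - 1) * (φ' s * ψ s - φ s * ψ' s))
      (-((l - μ) * (cos s ^ (n - 1) * (φ s * ψ s)))) s := by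
  refine ((hasDerivAt_cos_pow_sub_one hn (cos_pos_of_mem_Ioo hs).ne').mul
    (((hφ s hs).2.fun_mul (hψ s hs).1).fun_sub ((hφ s hs).1.fun_mul (hψ s hs).2))).congr_deriv ?_
  ring

/-- The parameters whose odd solution stays positive on `(0, a]`. -/
def positiveParams (n : ℕ) (a : ℝ) : Set ℝ := {l | ∀ s ∈ Icc 0 a, 0 < evenPart n l s}

theorem zero_mem_positiveParams {n : ℕ} (hn : 1 ≤ n) {a : ℝ} (ha : a < π / 2) :
    0 ∈ positiveParams n a := by
  intro s hs
  have hsI : s ∈ Ioo (-(π / 2)) (π / 2) := ⟨by linarith [hs.1, pi_pos], by linarith [hs.2]⟩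
  exact oddSeries_zero_pos hn (sq_nonneg _) ((le_abs_self _).trans_lt (abs_sin_sq_lt_one hsI))

theorem isOpen_positiveParams {n : ℕ} (hn : 1 ≤ n) {a : ℝ} (ha : a < π / 2) :
    IsOpen (positiveParams n a) := by
  rw [isOpen_iff_mem_nhds]
  intro l hl
  refine isCompact_Icc.eventually_forall_of_forall_eventually fun s hs => ?_
  have hsI : s ∈ Ioo (-(π / 2)) (π / 2) := ⟨by linarith [hs.1, pi_pos], by linarith [hs.2]⟩
  exact (continuousAt_evenPart hn l hsI).eventually (lt_mem_nhds (hl s hs))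

theorem exists_positive_dirichlet_solution {n : ℕ} (hn : 1 ≤ n) {a : ℝ} (ha : a < π / 2)
    (hB : BddAbove (positiveParams n a)) (ha0 : 0 < a) :
    ∃ l, IsLUB (positiveParams n a) l ∧ (∀ s ∈ Ico 0 a, 0 < evenPart n l s) ∧
      evenPart n l a = 0 := by
  have hIcc : ∀ s ∈ Icc 0 a, s ∈ Ioo (-(π / 2)) (π / 2) := fun s hs =>
    ⟨by linarith [hs.1, pi_pos], by linarith [hs.2]⟩
  have hcontl : ∀ l, ∀ s ∈ Icc 0 a, ContinuousAt (fun l => evenPart n l s) l := fun l s hs =>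
    (continuousAt_evenPart hn l (hIcc s hs)).comp
      (f := fun l : ℝ => (l, s)) (x := l) (by fun_prop)
  have hconts : ∀ l, ∀ s ∈ Icc 0 a, ContinuousAt (evenPart n l) s := fun l s hs =>
    (continuousAt_evenPart hn l (hIcc s hs)).comp
      (f := fun s : ℝ => (l, s)) (x := s) (by fun_prop)
  have h0S := zero_mem_positiveParams hn ha
  have hlub := isLUB_csSup ⟨0, h0S⟩ hB
  have hopen := isOpen_positiveParams hn ha
  set l := sSup (positiveParams n a) with hl
  have hlS : l ∉ positiveParams n a := by
    intro hmem
    obtain ⟨ε, hε, hball⟩ := Metric.isOpen_iff.1 hopen l hmem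
    have : l + ε / 2 ∈ positiveParams n a := hball (by
      simp [abs_of_pos hε, hε])
    linarith [hlub.1 this]
  have hl0 : 0 < l := lt_of_le_of_ne (hlub.1 h0S) fun h => hlS (h ▸ h0S)
  have hnonneg : ∀ s ∈ Icc 0 a, 0 ≤ evenPart n l s := by
    intro s hs
    have hclosed : IsClosed {l | 0 ≤ evenPart n l s} :=
      isClosed_le continuous_const (continuous_iff_continuousAt.2 fun l => hcontl l s hs)
    exact closure_minimal (fun μ hμ => (hμ s hs).le) hclosed (csSup_mem_closure ⟨0, h0S⟩ hB)
  have hIoo : ∀ s ∈ Ioo 0 a, evenPart n l s ≠ 0 := by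
    intro s₁ hs₁ hzero
    obtain ⟨φ', hφ⟩ := exists_solvesModel_oddSol hn l
    obtain ⟨ψ', hψ⟩ := exists_solvesModel_oddSol hn 0
    have hsinpos : ∀ s ∈ Ioo 0 a, 0 < sin s := fun s hs =>
      sin_pos_of_pos_of_lt_pi hs.1 (by linarith [hs.2, pi_pos])
    have hs₁' := hIcc s₁ (Ioo_subset_Icc_self hs₁)
    have hd : φ' s₁ = 0 := by
      refine IsLocalMin.hasDerivAt_eq_zero ?_ (hφ s₁ hs₁').1
      filter_upwards [Ioo_mem_nhds hs₁.1 hs₁.2] with s hs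
      rw [oddSol, hzero, mul_zero]
      exact mul_nonneg (hsinpos s hs).le (hnonneg s (Ioo_subset_Icc_self hs))
    have hW := fun s hs => hφ.hasDerivAt_wronskian hn hψ (s := s) hs
    set W := fun s => cos s ^ (n - 1) * (φ' s * oddSol n 0 s - oddSol n l s * ψ' s) with hWdef
    have hsub : Icc 0 s₁ ⊆ Icc 0 a := Icc_subset_Icc_right hs₁.2.le
    have hanti : AntitoneOn W (Icc 0 s₁) := by
      refine antitoneOn_of_hasDerivWithinAt_nonpos (convex_Icc 0 s₁)
        (fun s hs => (hW s (hIcc s (hsub hs))).continuousAt.continuousWithinAt)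
        (fun s hs => (hW s (hIcc s (hsub (interior_subset hs)))).hasDerivWithinAt) fun s hs => ?_
      rw [interior_Icc] at hs
      have hs' : s ∈ Ioo 0 a := ⟨hs.1, hs.2.trans hs₁.2⟩
      have h1 := hsinpos s hs'
      have h2 := hnonneg s (Ioo_subset_Icc_self hs')
      have h3 := h0S s (Ioo_subset_Icc_self hs')
      have h4 := cos_pos_of_mem_Ioo (hIcc s (Ioo_subset_Icc_self hs'))
      rw [neg_nonpos, sub_zero, oddSol, oddSol]
      positivity
    have hW0 : W 0 = 0 := by simp [hWdef, oddSol_zero]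
    have hW1 : W s₁ = 0 := by simp [hWdef, hd, oddSol, hzero]
    have hWz : ∀ s ∈ Icc 0 s₁, W s = 0 := fun s hs => le_antisymm
      (hW0 ▸ hanti (left_mem_Icc.2 hs₁.1.le) hs hs.1)
      (hW1 ▸ hanti hs (right_mem_Icc.2 hs₁.1.le) hs.2)
    have hev : ∀ s ∈ Ioo 0 s₁, evenPart n l s = 0 := by
      intro s hs
      have hs' : s ∈ Ioo 0 a := ⟨hs.1, hs.2.trans hs₁.2⟩
      have hz : HasDerivAt W 0 s := by
        refine (hasDerivAt_const s (0 : ℝ)).congr_of_eventuallyEq ?_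
        filter_upwards [Ioo_mem_nhds hs.1 hs.2] with t ht
        exact hWz t (Ioo_subset_Icc_self ht)
      have h5 := (hW s (hIcc s (Ioo_subset_Icc_self hs'))).unique hz
      have h1 := (hsinpos s hs').ne'
      have h3 := (h0S s (Ioo_subset_Icc_self hs')).ne'
      have h4 := (cos_pos_of_mem_Ioo (hIcc s (Ioo_subset_Icc_self hs'))).ne'
      simpa [oddSol, hl0.ne', h1, h3, h4] using h5
    have hpos0 : ∀ᶠ s in 𝓝[>] (0 : ℝ), 0 < evenPart n l s :=
      ((hconts l 0 (left_mem_Icc.2 ha0.le)).eventually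
        (lt_mem_nhds (by rw [evenPart_zero]; exact one_pos))).filter_mono nhdsWithin_le_nhds
    obtain ⟨s, hs, hs2⟩ := (hpos0.and (Ioo_mem_nhdsGT hs₁.1)).exists
    exact hs.ne' (hev s hs2)
  have hpos : ∀ s ∈ Ico 0 a, 0 < evenPart n l s := by
    intro s hs
    rcases hs.1.eq_or_lt with h | h
    · rw [← h, evenPart_zero]
      exact one_pos
    · exact lt_of_le_of_ne (hnonneg s (Ico_subset_Icc_self hs)) (hIoo s ⟨h, hs.2⟩).symm
  refine ⟨l, hlub, hpos, ?_⟩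
  by_contra hne
  refine hlS fun s hs => ?_
  rcases hs.2.eq_or_lt with h | h
  · exact h ▸ lt_of_le_of_ne (hnonneg a (right_mem_Icc.2 ha0.le)) (Ne.symm hne)
  · exact hpos s ⟨hs.1, h⟩

theorem integrableOn_deriv_sq_mul {a : ℝ} {χ w : ℝ → ℝ} (ha : 0 < a)
    (hχ : ContDiffOn ℝ 1 χ (Icc (-a) a)) (hw : Continuous w) :
    MeasureTheory.IntegrableOn (fun s => deriv χ s ^ 2 * w s) (Icc (-a) a) := by
  have hc : ContinuousOn (fun s => derivWithin χ (Icc (-a) a) s ^ 2 * w s) (Icc (-a) a) :=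
    ((hχ.continuousOn_derivWithin (uniqueDiffOn_Icc (by linarith)) le_rfl).pow 2).mul
      hw.continuousOn
  have hi := hc.integrableOn_Icc (μ := MeasureTheory.volume)
  rw [integrableOn_Icc_iff_integrableOn_Ioo] at hi ⊢
  refine hi.congr_fun (fun s hs => ?_) measurableSet_Ioo
  simp only [derivWithin_of_mem_nhds (Icc_mem_nhds hs.1 hs.2)]

theorem integral_symm_eq_two_mul {a : ℝ} {f : ℝ → ℝ} (ha : 0 ≤ a)
    (hf : MeasureTheory.IntegrableOn f (Icc (-a) a)) (heven : ∀ s ∈ Ioo 0 a, f (-s) = f s) :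
    ∫ s in (-a)..a, f s = 2 * ∫ s in (0 : ℝ)..a, f s := by
  have h1 : IntervalIntegrable f MeasureTheory.volume (-a) 0 := by
    rw [intervalIntegrable_iff_integrableOn_Icc_of_le (by linarith)]
    exact hf.mono_set (Icc_subset_Icc_right ha)
  have h2 : IntervalIntegrable f MeasureTheory.volume 0 a := by
    rw [intervalIntegrable_iff_integrableOn_Icc_of_le ha]
    exact hf.mono_set (Icc_subset_Icc_left (by linarith))
  rw [← intervalIntegral.integral_add_adjacent_intervals h1 h2, two_mul]
  congr 1
  have h3 : ∫ s in (-a)..0, f s = ∫ s in (0 : ℝ)..a, f (-s) := by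
    rw [intervalIntegral.integral_comp_neg, neg_zero]
  rw [h3, intervalIntegral.integral_of_le ha, intervalIntegral.integral_of_le ha,
    MeasureTheory.integral_Ioc_eq_integral_Ioo, MeasureTheory.integral_Ioc_eq_integral_Ioo]
  exact MeasureTheory.setIntegral_congr_fun measurableSet_Ioo heven

theorem sinc_pos_of_abs_lt_pi {x : ℝ} (hx : |x| < π) : 0 < sinc x := by
  have key : ∀ y : ℝ, 0 < y → y < π → 0 < sinc y := fun y h0 h1 => by
    rw [sinc_of_ne_zero h0.ne']
    exact div_pos (sin_pos_of_pos_of_lt_pi h0 h1) h0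
  rcases lt_trichotomy x 0 with h | h | h
  · rw [← sinc_neg]
    rw [abs_of_neg h] at hx
    exact key _ (by linarith) hx
  · simp [h]
  · rw [abs_of_pos h] at hx
    exact key _ h hx

theorem mul_sinc (x : ℝ) : x * sinc x = sin x := by
  rcases eq_or_ne x 0 with h | h
  · simp [h]
  · rw [sinc_of_ne_zero h]
    field_simp

/-- Barta's inequality on `[0, a]` for functions vanishing at both endpoints. -/
theorem mul_integral_le_integral_deriv_sq {n : ℕ} (hn : 1 ≤ n) {a l : ℝ} (ha0 : 0 < a)
    (ha : a < π / 2) (hl : l ∈ positiveParams n a) {χ : ℝ → ℝ}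
    (hχ : ContDiffOn ℝ 1 χ (Icc (-a) a)) (hχ0 : χ 0 = 0) (hχa : χ a = 0) :
    l * ∫ s in (0 : ℝ)..a, χ s ^ 2 * cos s ^ (n - 1) ≤
      ∫ s in (0 : ℝ)..a, deriv χ s ^ 2 * cos s ^ (n - 1) := by
  obtain ⟨φ', hφ⟩ := exists_solvesModel_oddSol hn l
  have hI : ∀ s ∈ Icc 0 a, s ∈ Ioo (-(π / 2)) (π / 2) := fun s hs =>
    ⟨by linarith [hs.1, pi_pos], by linarith [hs.2]⟩
  have hsub : Icc 0 a ⊆ Icc (-a) a := Icc_subset_Icc_left (by linarith)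
  have hdiff : ∀ s ∈ Ioo (-a) a, DifferentiableAt ℝ χ s := fun s hs =>
    (hχ.differentiableOn one_ne_zero s (Ioo_subset_Icc_self hs)).differentiableAt
      (Icc_mem_nhds hs.1 hs.2)
  set G := fun s => cos s ^ (n - 1) * φ' s * (dslope χ 0 s ^ 2 * s) /
    (sinc s * evenPart n l s) with hG
  have hdpos : ∀ s ∈ Icc 0 a, 0 < sinc s * evenPart n l s := fun s hs =>
    mul_pos (sinc_pos_of_abs_lt_pi (by rw [abs_of_nonneg hs.1]; linarith [hs.2, pi_pos])) (hl s hs)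
  have hGc : ContinuousOn G (Icc 0 a) := by
    have h1 : ContinuousOn (dslope χ 0) (Icc 0 a) :=
      ((continuousOn_dslope (Icc_mem_nhds (by linarith) ha0)).2
        ⟨hχ.continuousOn, hdiff 0 ⟨by linarith, ha0⟩⟩).mono hsub
    have h2 : ContinuousOn φ' (Icc 0 a) := fun s hs =>
      (hφ s (hI s hs)).2.continuousAt.continuousWithinAt
    have h3 : ContinuousOn (evenPart n l) (Icc 0 a) :=
      (contDiffOn_evenPart hn l 0).continuousOn.mono hI
    have h4 := continuous_sinc.continuousOn (s := Icc 0 a)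
    exact ContinuousOn.div (by fun_prop) (by fun_prop) fun s hs => (hdpos s hs).ne'
  have hG' : ∀ s ∈ Ioo 0 a, HasDerivAt G (cos s ^ (n - 1) *
      (2 * χ s * deriv χ s * φ' s / oddSol n l s - l * χ s ^ 2
        - χ s ^ 2 * φ' s ^ 2 / oddSol n l s ^ 2)) s := by
    intro s hs
    have hs' := Ioo_subset_Icc_self hs
    have hφs : oddSol n l s ≠ 0 := by
      rw [oddSol, ← mul_sinc, mul_assoc]
      exact (mul_pos hs.1 (hdpos s hs')).ne'
    have hd := (((hasDerivAt_cos_pow_sub_one hn (cos_pos_of_mem_Ioo (hI s hs')).ne').fun_mul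
      (hφ s (hI s hs')).2).fun_mul ((hdiff s ⟨by linarith [hs.1], hs.2⟩).hasDerivAt.fun_pow 2)).fun_div
      (hφ s (hI s hs')).1 hφs
    refine (hd.congr_of_eventuallyEq ?_).congr_deriv ?_
    · filter_upwards [Ioo_mem_nhds hs.1 hs.2] with t ht
      have ht0 := ht.1.ne'
      have h5 := mul_ne_zero_iff.1 (hdpos t (Ioo_subset_Icc_self ht)).ne'
      obtain ⟨h5, h6⟩ := h5
      simp only [hG, oddSol, ← mul_sinc, dslope_of_ne _ ht0, slope_def_field, hχ0, sub_zero]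
      field_simp
    · field_simp
      ring
  have hint : MeasureTheory.IntegrableOn (fun s => deriv χ s ^ 2 * cos s ^ (n - 1)) (Icc 0 a) :=
    (integrableOn_deriv_sq_mul ha0 hχ (by fun_prop)).mono_set hsub
  have hint2 : MeasureTheory.IntegrableOn (fun s => l * (χ s ^ 2 * cos s ^ (n - 1))) (Icc 0 a) := by
    have := hχ.continuousOn.mono hsub
    exact ContinuousOn.integrableOn_Icc (by fun_prop)
  have hmain := intervalIntegral.sub_le_integral_of_hasDeriv_right_of_le ha0.le hGc
    (fun s hs => (hG' s hs).hasDerivWithinAt) (hint.sub hint2) fun s hs => by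
      have hw := (pow_pos (cos_pos_of_mem_Ioo (hI s (Ioo_subset_Icc_self hs))) (n - 1)).le
      have h6 := mul_nonneg hw (sq_nonneg (deriv χ s - χ s * φ' s / oddSol n l s))
      simp only [Pi.sub_apply]
      have h7 : cos s ^ (n - 1) * (deriv χ s - χ s * φ' s / oddSol n l s) ^ 2 =
        (deriv χ s ^ 2 * cos s ^ (n - 1) - l * (χ s ^ 2 * cos s ^ (n - 1))) - cos s ^ (n - 1) *
      (2 * χ s * deriv χ s * φ' s / oddSol n l s - l * χ s ^ 2
        - χ s ^ 2 * φ' s ^ 2 / oddSol n l s ^ 2) := by ring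
      linarith
  have hGa : G a = 0 := by
    simp [hG, dslope_of_ne _ ha0.ne', slope_def_field, hχ0, hχa]
  have hG0 : G 0 = 0 := by simp [hG]
  rw [hGa, hG0, sub_zero] at hmain
  simp only [Pi.sub_apply] at hmain
  rw [intervalIntegral.integral_sub, intervalIntegral.integral_const_mul] at hmain
  · linarith
  · exact (intervalIntegrable_iff_integrableOn_Icc_of_le ha0.le).2 hint
  · exact (intervalIntegrable_iff_integrableOn_Icc_of_le ha0.le).2 hint2

theorem integral_sq_mul_cos_pow_pos {a : ℝ} (n : ℕ) (ha0 : 0 < a) (ha : a < π / 2) {χ : ℝ → ℝ}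
    (hχ : ContinuousOn χ (Icc (-a) a)) (hne : ∃ s ∈ Icc (-a) a, χ s ≠ 0) :
    0 < ∫ s in (-a)..a, χ s ^ 2 * cos s ^ (n - 1) := by
  have hcos : ∀ s ∈ Icc (-a) a, 0 < cos s := fun s hs =>
    cos_pos_of_mem_Ioo ⟨by linarith [hs.1], by linarith [hs.2]⟩
  refine intervalIntegral.integral_pos (by linarith) (by fun_prop) (fun s hs => ?_) ?_
  · have := hcos s (Ioc_subset_Icc_self hs)
    positivity
  · obtain ⟨s, hs, hsne⟩ := hne
    have := hcos s hs
    exact ⟨s, hs, by positivity⟩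

theorem le_modelLam2_of_mem_positiveParams {n : ℕ} (hn : 1 ≤ n) {D l : ℝ} (hD0 : 0 < D)
    (hD : D < π) (hl : l ∈ positiveParams n (D / 2)) : l ≤ modelLam2 n D := by
  have ha0 : 0 < D / 2 := by linarith
  have ha : D / 2 < π / 2 := by linarith
  refine le_csInf (Set.Nonempty.image _ ⟨fun s => sin (π / (D / 2) * s), ?_, ?_, ?_, ?_, ?_⟩) ?_
  · exact (contDiff_sin.comp (contDiff_const.mul contDiff_id)).contDiffOn
  · refine ⟨D / 4, ⟨by linarith, by linarith⟩, ?_⟩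
    have : π / (D / 2) * (D / 4) = π / 2 := by field_simp; norm_num
    simp [this]
  · intro s _
    simp
  · have : π / (D / 2) * (-(D / 2)) = -π := by field_simp
    simp [this]
  · have : π / (D / 2) * (D / 2) = π := by field_simp
    simp [this]
  rintro _ ⟨χ, ⟨hχ, hne, hodd, -, hχa⟩, rfl⟩
  have hχ0 : χ 0 = 0 := by
    have := hodd 0 ⟨by linarith, by linarith⟩
    rw [neg_zero] at this
    linarith
  rw [rayleighQ, le_div_iff₀ (integral_sq_mul_cos_pow_pos n ha0 ha hχ.continuousOn hne)]
  have hc := hχ.continuousOn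
  rw [integral_symm_eq_two_mul ha0.le (ContinuousOn.integrableOn_Icc (by fun_prop)),
    integral_symm_eq_two_mul ha0.le (integrableOn_deriv_sq_mul ha0 hχ (by fun_prop))]
  · linarith [mul_integral_le_integral_deriv_sq hn ha0 ha hl hχ hχ0 hχa]
  · intro s hs
    have h1 : χ =ᶠ[𝓝 s] fun t => -χ (-t) := by
      filter_upwards [Ioo_mem_nhds (show -(D / 2) < s by linarith [hs.1]) hs.2] with t ht
      rw [hodd t (Ioo_subset_Icc_self ht), neg_neg]
    have h2 : deriv χ s = deriv χ (-s) := by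
      rw [h1.deriv_eq, deriv.fun_neg, deriv_comp_neg, neg_neg]
    rw [h2, cos_neg]
  · intro s hs
    rw [hodd s ⟨by linarith [hs.1], hs.2.le⟩, cos_neg, neg_sq]

theorem contDiff_sinc (k : ℕ) : ContDiff ℝ k sinc := by
  rw [contDiff_iff_contDiffAt]
  intro x
  rcases eq_or_ne x 0 with rfl | hx
  · obtain ⟨p, hp⟩ := (analyticAt_sin : AnalyticAt ℝ sin 0)
    rw [sinc_eq_dslope]
    exact AnalyticAt.contDiffAt ⟨_, hp.has_fpower_series_dslope_fslope⟩
  · refine ((contDiffAt_id.inv hx).mul contDiff_sin.contDiffAt).congr_of_eventuallyEq ?_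
    filter_upwards [isOpen_ne.mem_nhds hx] with y hy
    rw [sinc_of_ne_zero hy, div_eq_inv_mul]
    rfl

/-- If `W` vanishes at both endpoints and `W' = k P` with `P ≥ 0` and `k` increasing,
then `W ≤ 0`. -/
theorem nonpos_of_hasDerivAt_mul_of_monotoneOn {a b : ℝ} {W k P : ℝ → ℝ}
    (hWc : ContinuousOn W (Icc a b)) (hWa : W a = 0) (hWb : W b = 0)
    (hW : ∀ s ∈ Ioo a b, HasDerivAt W (k s * P s) s) (hP : ∀ s ∈ Ioo a b, 0 ≤ P s)
    (hk : MonotoneOn k (Ioo a b)) : ∀ s ∈ Ioo a b, W s ≤ 0 := by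
  intro s hs
  rcases le_total (k s) 0 with h | h
  · have hanti : AntitoneOn W (Icc a s) := by
      refine antitoneOn_of_hasDerivWithinAt_nonpos (f' := fun t => k t * P t) (convex_Icc a s)
        (hWc.mono (Icc_subset_Icc_right hs.2.le)) (fun t ht => ?_) fun t ht => ?_ <;>
      rw [interior_Icc] at ht
      · exact (hW t ⟨ht.1, ht.2.trans hs.2⟩).hasDerivWithinAt
      · have ht' : t ∈ Ioo a b := ⟨ht.1, ht.2.trans hs.2⟩
        exact mul_nonpos_of_nonpos_of_nonneg ((hk ht' hs ht.2.le).trans h) (hP t ht')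
    exact hWa ▸ hanti (left_mem_Icc.2 hs.1.le) (right_mem_Icc.2 hs.1.le) hs.1.le
  · have hmono : MonotoneOn W (Icc s b) := by
      refine monotoneOn_of_hasDerivWithinAt_nonneg (f' := fun t => k t * P t) (convex_Icc s b)
        (hWc.mono (Icc_subset_Icc_left hs.1.le)) (fun t ht => ?_) fun t ht => ?_ <;>
      rw [interior_Icc] at ht
      · exact (hW t ⟨hs.1.trans ht.1, ht.2⟩).hasDerivWithinAt
      · have ht' : t ∈ Ioo a b := ⟨hs.1.trans ht.1, ht.2⟩
        exact mul_nonneg (h.trans (hk hs ht' ht.1.le)) (hP t ht')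
    exact hWb ▸ hmono (left_mem_Icc.2 hs.2.le) (right_mem_Icc.2 hs.2.le) hs.2.le

/-- With `ψ = cos^{(n-1)/2} φ` and `b = π/(2a)`, the quotient `ψ / sin(2bs)` is decreasing on
`(0, a)`. -/
theorem SolvesModel.wronskian_sin_nonpos {n : ℕ} (hn : 3 ≤ n) {a b l : ℝ} (ha0 : 0 < a)
    (ha : a < π / 2) (hb : b * a = π / 2) {φ φ' : ℝ → ℝ} (hφ : SolvesModel n l φ φ')
    (hφ0 : φ 0 = 0) (hφa : φ a = 0) (hpos : ∀ s ∈ Ioo 0 a, 0 < φ s) :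
    ∀ s ∈ Ioo 0 a, φ' s * sin (2 * b * s) - (n - 1) / 2 * tan s * φ s * sin (2 * b * s)
      - φ s * (2 * b * cos (2 * b * s)) ≤ 0 := by
  have hn1 : 1 ≤ n := by lia
  have hn3 : (3 : ℝ) ≤ n := by exact_mod_cast hn
  have hb0 : 0 < b := pos_of_mul_pos_left (hb ▸ by positivity) ha0.le
  have hI : ∀ s ∈ Icc 0 a, s ∈ Ioo (-(π / 2)) (π / 2) := fun s hs =>
    ⟨by linarith [hs.1, pi_pos], by linarith [hs.2]⟩
  set W := fun s => √(cos s ^ (n - 1)) * (φ' s * sin (2 * b * s)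
    - (n - 1) / 2 * tan s * φ s * sin (2 * b * s) - φ s * (2 * b * cos (2 * b * s))) with hW
  have hW' : ∀ s ∈ Icc 0 a, HasDerivAt W
      ((((n - 1) / 2 * ((n - 1) / 2 - 1)) * tan s ^ 2 - (n - 1) / 2 - l + 4 * b ^ 2) *
        (√(cos s ^ (n - 1)) * (φ s * sin (2 * b * s)))) s := by
    intro s hs
    have hc := cos_pos_of_mem_Ioo (hI s hs)
    have hsq : 0 < √(cos s ^ (n - 1)) := sqrt_pos.2 (pow_pos hc _)
    have d0 := (hasDerivAt_cos_pow_sub_one hn1 hc.ne').sqrt (pow_pos hc _).ne'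
    have d1 : HasDerivAt (fun s => √(cos s ^ (n - 1)))
        (-((n - 1) / 2 * tan s * √(cos s ^ (n - 1)))) s := by
      refine d0.congr_deriv ?_
      nth_rewrite 1 [← sq_sqrt (pow_pos hc (n - 1)).le]
      field_simp
    have hlin : HasDerivAt (fun s => 2 * b * s) (2 * b) s := by
      simpa using (hasDerivAt_id s).const_mul (2 * b)
    have d2 := hlin.sin
    have d3 := hlin.cos
    have d4 := hasDerivAt_tan hc.ne'
    have hsec : 1 / cos s ^ 2 = 1 + tan s ^ 2 := by
      rw [tan_eq_sin_div_cos]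
      field_simp
      linarith [sin_sq_add_cos_sq s]
    rw [hsec] at d4
    obtain ⟨e1, e2⟩ := hφ s (hI s hs)
    refine (d1.fun_mul (((e2.fun_mul d2).fun_sub (((d4.const_mul ((n - 1) / 2 : ℝ)).fun_mul
      e1).fun_mul d2)).fun_sub (e1.fun_mul (d3.const_mul (2 * b))))).congr_deriv ?_
    ring
  have hWle := nonpos_of_hasDerivAt_mul_of_monotoneOn
    (fun s hs => (hW' s hs).continuousAt.continuousWithinAt) (by simp [hW, hφ0])
    (by
      have : 2 * b * a = π := by linarith
      simp [hW, hφa, this])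
    (fun s hs => hW' s (Ioo_subset_Icc_self hs))
    (fun s hs => by
      have h1 := hpos s hs
      have h2 : 0 < sin (2 * b * s) := by
        refine sin_pos_of_pos_of_lt_pi (mul_pos (by positivity) hs.1) ?_
        nlinarith [hs.2]
      positivity)
    (fun s hs t ht hst => by
      have h1 : tan s ≤ tan t := by
        rcases hst.eq_or_lt with h | h
        · rw [h]
        · exact (tan_lt_tan_of_lt_of_lt_pi_div_two (by linarith [hs.1, pi_pos])
            (by linarith [ht.2]) h).le
      have h0 : 0 ≤ tan s := tan_nonneg_of_nonneg_of_le_pi_div_two hs.1.le (by linarith [hs.2])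
      have h2 : 0 ≤ ((n : ℝ) - 1) / 2 * (((n : ℝ) - 1) / 2 - 1) :=
        mul_nonneg (by linarith) (by linarith)
      gcongr)
  intro s hs
  have hsq : 0 < √(cos s ^ (n - 1)) :=
    sqrt_pos.2 (pow_pos (cos_pos_of_mem_Ioo (hI s (Ioo_subset_Icc_self hs))) _)
  exact nonpos_of_mul_nonpos_right (hWle s hs) hsq

/-- The quotient `φ(s) / sin(bs)`, continued smoothly through `s = 0`. -/
def quotSin (n : ℕ) (l b s : ℝ) : ℝ := evenPart n l s * sinc s / (b * sinc (b * s))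

theorem modelLam1_le {n : ℕ} (hn : 3 ≤ n) {D l : ℝ} (hD0 : 0 < D) (hD : D < π)
    (hpos : ∀ s ∈ Ico 0 (D / 2), 0 < evenPart n l s) (hzero : evenPart n l (D / 2) = 0) :
    modelLam1 n D ≤ l - 3 * π ^ 2 / D ^ 2 := by
  have hn1 : 1 ≤ n := by lia
  obtain ⟨φ', hφ⟩ := exists_solvesModel_oddSol hn1 l
  set a := D / 2 with haD
  have ha0 : 0 < a := by linarith
  have ha : a < π / 2 := by linarith
  set b := π / D with hbD
  have hb0 : 0 < b := by positivity
  have hb : b * a = π / 2 := by rw [hbD, haD]; field_simp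
  set u := quotSin n l b with hu
  set J := Ioo (-(π / 2)) (π / 2) ∩ Ioo (-D) D with hJ
  have hJo : IsOpen J := isOpen_Ioo.inter isOpen_Ioo
  have hJI : ∀ s ∈ Icc (-a) a, s ∈ J := fun s hs =>
    ⟨⟨by linarith [hs.1], by linarith [hs.2]⟩, ⟨by linarith [hs.1], by linarith [hs.2]⟩⟩
  have hbs : ∀ s ∈ J, |b * s| < π := fun s hs => by
    have h1 : |s| < D := abs_lt.2 hs.2
    rw [abs_mul, abs_of_pos hb0]
    calc b * |s| < b * D := by gcongr
      _ = π := by rw [hbD]; field_simp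
  have hden : ∀ s ∈ J, b * sinc (b * s) ≠ 0 := fun s hs =>
    (mul_pos hb0 (sinc_pos_of_abs_lt_pi (hbs s hs))).ne'
  have hu2 : ContDiffOn ℝ 2 u J := by
    have h1 := (contDiffOn_evenPart hn1 l 2).mono (inter_subset_left : J ⊆ _)
    have h2 := contDiff_sinc 2
    refine ContDiffOn.div (h1.mul h2.contDiffOn) ?_ hden
    exact (contDiff_const.mul (h2.comp (contDiff_const.mul contDiff_id))).contDiffOn
  have hu1 : ∀ s ∈ J, HasDerivAt u (deriv u s) s := fun s hs =>
    ((hu2.differentiableOn two_ne_zero s hs).differentiableAt (hJo.mem_nhds hs)).hasDerivAt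
  have hdu : ContDiffOn ℝ 1 (deriv u) J :=
    ((contDiffOn_succ_iff_deriv_of_isOpen (n := 1) hJo).1 (by norm_num; exact hu2)).2.2
  have hu1' : ∀ s ∈ J, HasDerivAt (deriv u) (deriv (deriv u) s) s := fun s hs =>
    ((hdu.differentiableOn one_ne_zero s hs).differentiableAt (hJo.mem_nhds hs)).hasDerivAt
  have hφu : ∀ s ∈ J, oddSol n l s = u s * sin (b * s) := fun s hs => by
    have := hden s hs
    rw [hu, quotSin, oddSol, ← mul_sinc, ← mul_sinc, div_mul_eq_mul_div, eq_div_iff this]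
    ring
  have hlin : ∀ s, HasDerivAt (fun s => b * s) b s := fun s => by
    simpa using (hasDerivAt_id s).const_mul b
  have hφ'u : ∀ s ∈ J, φ' s = deriv u s * sin (b * s) + u s * (cos (b * s) * b) := fun s hs => by
    refine (hφ s hs.1).1.unique (((hu1 s hs).fun_mul (hlin s).sin).congr_of_eventuallyEq ?_)
    filter_upwards [hJo.mem_nhds hs] with t ht using hφu t ht
  have hode : ∀ s ∈ J, (n - 1) * tan s * φ' s - l * oddSol n l s =
      deriv (deriv u) s * sin (b * s) + deriv u s * (cos (b * s) * b) +
      (deriv u s * (cos (b * s) * b) + u s * (-sin (b * s) * b * b)) := fun s hs => by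
    refine (hφ s hs.1).2.unique ((((hu1' s hs).fun_mul (hlin s).sin).fun_add
      ((hu1 s hs).fun_mul ((hlin s).cos.mul_const b))).congr_of_eventuallyEq ?_)
    filter_upwards [hJo.mem_nhds hs] with t ht using hφ'u t ht
  have hueven : ∀ s, u (-s) = u s := fun s => by
    simp [hu, quotSin, evenPart_neg, sinc_neg]
  have hdodd : ∀ s, deriv u (-s) = -deriv u s := fun s => by
    have h1 : (fun t => u (-t)) = u := funext hueven
    have h2 := deriv_comp_neg u s
    rw [h1] at h2
    linarith
  have hd0 : deriv u 0 = 0 := by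
    have := hdodd 0
    rw [neg_zero] at this
    linarith
  have hua : u a = 0 := by simp [hu, quotSin, hzero]
  have hu0 : 0 < u 0 := by
    simp [hu, quotSin, evenPart_zero, hb0]
  have hsinb : ∀ s ∈ Ioo 0 a, 0 < sin (b * s) := fun s hs => by
    refine sin_pos_of_pos_of_lt_pi (mul_pos hb0 hs.1) ?_
    nlinarith [hs.2, pi_pos]
  have hφpos : ∀ s ∈ Ioo 0 a, 0 < oddSol n l s := fun s hs =>
    mul_pos (sin_pos_of_pos_of_lt_pi hs.1 (by linarith [hs.2])) (hpos s (Ioo_subset_Ico_self hs))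
  have hupos : ∀ s ∈ Ioo 0 a, 0 < u s := fun s hs => by
    have h1 := hφpos s hs
    rw [hφu s (hJI s ⟨by linarith [hs.1], hs.2.le⟩)] at h1
    exact pos_of_mul_pos_left h1 (hsinb s hs).le
  have hW := hφ.wronskian_sin_nonpos hn ha0 ha hb (oddSol_zero n l) (by rw [oddSol, hzero, mul_zero])
    hφpos
  have hsuper : ∀ s ∈ Ioo 0 a,
      0 ≤ deriv (deriv u) s - (n - 1) * tan s * deriv u s + (l - 3 * b ^ 2) * u s := by
    intro s hs
    have hsJ := hJI s ⟨by linarith [hs.1], hs.2.le⟩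
    have hS := hsinb s hs
    have h1 := hode s hsJ
    have h2 := hW s hs
    rw [hφ'u s hsJ, hφu s hsJ] at h1 h2
    rw [mul_assoc 2 b s, sin_two_mul, cos_two_mul'] at h2
    have h3 : deriv u s * cos (b * s) - (n - 1) / 2 * tan s * cos (b * s) * u s
        + b * sin (b * s) * u s ≤ 0 := by
      refine nonpos_of_mul_nonpos_right (a := 2 * sin (b * s) ^ 2) ?_ (by positivity)
      linarith
    refine nonneg_of_mul_nonneg_right (a := sin (b * s)) ?_ hS
    have h4 := mul_nonneg_of_nonpos_of_nonpos (show -(2 * b) ≤ 0 by linarith) h3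
    linarith
  have hsub : Icc 0 a ⊆ Icc (-a) a := Icc_subset_Icc_left (by linarith)
  have huc : ContinuousOn u (Icc (-a) a) := hu2.continuousOn.mono hJI
  have hduc : ContinuousOn (deriv u) (Icc (-a) a) := hdu.continuousOn.mono hJI
  have hint1 : MeasureTheory.IntegrableOn (fun s => deriv u s ^ 2 * cos s ^ (n - 1))
      (Icc (-a) a) := ContinuousOn.integrableOn_Icc (by fun_prop)
  have hint2 : MeasureTheory.IntegrableOn (fun s => u s ^ 2 * cos s ^ (n - 1))
      (Icc (-a) a) := ContinuousOn.integrableOn_Icc (by fun_prop)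
  have hmain : ∫ s in (0 : ℝ)..a, (deriv u s ^ 2 * cos s ^ (n - 1)
      - (l - 3 * b ^ 2) * (u s ^ 2 * cos s ^ (n - 1))) ≤
      cos a ^ (n - 1) * deriv u a * u a - cos 0 ^ (n - 1) * deriv u 0 * u 0 := by
    refine intervalIntegral.integral_le_sub_of_hasDeriv_right_of_le
      (g := fun s => cos s ^ (n - 1) * deriv u s * u s) ha0.le ?_
      (fun s hs => HasDerivAt.hasDerivWithinAt (((hasDerivAt_cos_pow_sub_one hn1
        (cos_pos_of_mem_Ioo (hJI s (hsub (Ioo_subset_Icc_self hs))).1).ne').fun_mul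
        (hu1' s (hJI s (hsub (Ioo_subset_Icc_self hs))))).fun_mul
        (hu1 s (hJI s (hsub (Ioo_subset_Icc_self hs))))))
      ((hint1.sub (hint2.const_mul _)).mono_set hsub) fun s hs => ?_
    · have h1 := huc.mono hsub
      have h2 := hduc.mono hsub
      fun_prop
    · have hw := pow_pos (cos_pos_of_mem_Ioo (hJI s (hsub (Ioo_subset_Icc_self hs))).1) (n - 1)
      have h1 := mul_nonneg (mul_pos hw (hupos s hs)).le (hsuper s hs)
      linarith
  rw [hua, hd0, mul_zero, mul_zero, zero_mul, sub_zero] at hmain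
  have hi1 := (intervalIntegrable_iff_integrableOn_Icc_of_le ha0.le).2 (hint1.mono_set hsub)
  have hi2 := (intervalIntegrable_iff_integrableOn_Icc_of_le ha0.le).2 (hint2.mono_set hsub)
  rw [intervalIntegral.integral_sub hi1 (hi2.const_mul _), intervalIntegral.integral_const_mul]
    at hmain
  have hne : ∃ s ∈ Icc (-a) a, u s ≠ 0 := ⟨0, ⟨by linarith, ha0.le⟩, hu0.ne'⟩
  have hR : rayleighQ n D u ≤ l - 3 * π ^ 2 / D ^ 2 := by
    rw [rayleighQ, div_le_iff₀ (integral_sq_mul_cos_pow_pos n ha0 ha huc hne), ← haD,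
      integral_symm_eq_two_mul ha0.le hint1 (fun s _ => by rw [hdodd, cos_neg, neg_sq]),
      integral_symm_eq_two_mul ha0.le hint2 (fun s _ => by rw [hueven, cos_neg])]
    have : 3 * π ^ 2 / D ^ 2 = 3 * b ^ 2 := by rw [hbD]; ring
    rw [this]
    linarith
  have hmem : u ∈ {φ : ℝ → ℝ | ContDiffOn ℝ 1 φ (Icc (-(D / 2)) (D / 2)) ∧
      (∃ s ∈ Icc (-(D / 2)) (D / 2), φ s ≠ 0) ∧ φ (-(D / 2)) = 0 ∧ φ (D / 2) = 0} :=
    ⟨(hu2.of_le one_le_two).mono hJI, hne, by rw [← haD, hueven, hua], hua⟩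
  rw [modelLam1]
  refine (csInf_le ⟨0, ?_⟩ (mem_image_of_mem _ hmem)).trans hR
  rintro _ ⟨χ, -, rfl⟩
  have hnn : ∀ f : ℝ → ℝ, 0 ≤ ∫ s in (-a)..a, f s ^ 2 * cos s ^ (n - 1) := fun f =>
    intervalIntegral.integral_nonneg (by linarith) fun s hs =>
      mul_nonneg (sq_nonneg _) (pow_pos (cos_pos_of_mem_Ioo (hJI s hs).1) _).le
  exact div_nonneg (hnn _) (hnn _)

/-- For `n ≥ 3` and `0 < D < π`, the gap of the one-dimensional
model satisfies `λ̄₂(n,D) − λ̄₁(n,D) ≥ 3π²/D²`. -/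
theorem model_gap_lower_bound (n : ℕ) (hn : 3 ≤ n) (D : ℝ) (hD0 : 0 < D) (hDpi : D < π) :
    modelLam2 n D - modelLam1 n D ≥ 3 * π ^ 2 / D ^ 2 := by
  have hn1 : 1 ≤ n := by lia
  have hupper : modelLam2 n D ∈ upperBounds (positiveParams n (D / 2)) := fun l hl =>
    le_modelLam2_of_mem_positiveParams hn1 hD0 hDpi hl
  obtain ⟨l, hlub, hpos, hzero⟩ := exists_positive_dirichlet_solution hn1
    (show D / 2 < π / 2 by linarith) ⟨_, hupper⟩ (by linarith)
  linarith [hlub.2 hupper, modelLam1_le hn hD0 hDpi hpos hzero]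
end
end

section
/- Let n = 2. Then the function D ↦ D²·(λ̄₂(2,D) − λ̄₁(2,D)) is strictly decreasing on (0, π): if 0 < D₁ < D₂ < π then D₁²·(λ̄₂(2,D₁) − λ̄₁(2,D₁)) > D₂²·(λ̄₂(2,D₂) − λ̄₁(2,D₂)). -/
open Real Set

noncomputable section

/-- The cosine weight, truncated from below so that it is positive on all of `ℝ`. -/
def truncCos (m t : ℝ) : ℝ := max (cos t) m

/-- The vector field of the Prüfer angle equation for `w u'' + w' u' + l w u = 0`, where
`w = truncCos m`. -/
def pruferField (m l t x : ℝ) : ℝ := cos x ^ 2 / truncCos m t + l * truncCos m t * sin x ^ 2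

lemma truncCos_continuous (m : ℝ) : Continuous (truncCos m) := by
  unfold truncCos; fun_prop

lemma truncCos_neg (m t : ℝ) : truncCos m (-t) = truncCos m t := by
  simp [truncCos]

lemma le_truncCos (m t : ℝ) : m ≤ truncCos m t := le_max_right _ _

lemma truncCos_le_one {m : ℝ} (hm1 : m ≤ 1) (t : ℝ) : truncCos m t ≤ 1 :=
  max_le (cos_le_one t) hm1

lemma truncCos_pos {m : ℝ} (hm : 0 < m) (t : ℝ) : 0 < truncCos m t :=
  hm.trans_le (le_truncCos m t)

lemma pruferField_nonneg {m l : ℝ} (hm : 0 < m) (hl : 0 ≤ l) (t x : ℝ) :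
    0 ≤ pruferField m l t x := by
  have := truncCos_pos hm t
  unfold pruferField; positivity

lemma pruferField_pos {m l : ℝ} (hm : 0 < m) (hl : 0 < l) (t x : ℝ) :
    0 < pruferField m l t x := by
  have hw := truncCos_pos hm t
  have h1 := sin_sq_add_cos_sq x
  unfold pruferField
  rcases eq_or_ne (cos x) 0 with h | h
  · have : sin x ^ 2 = 1 := by rw [h] at h1; linarith
    rw [this]; positivity
  · positivity

lemma abs_pruferField_le {m : ℝ} (hm : 0 < m) (hm1 : m ≤ 1) (l t x : ℝ) :
    |pruferField m l t x| ≤ 1 / m + |l| := by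
  have hw := truncCos_pos hm t
  have h1 := sin_sq_add_cos_sq x
  unfold pruferField
  refine (abs_add_le _ _).trans (add_le_add ?_ ?_)
  · rw [abs_of_nonneg (by positivity)]
    exact div_le_div₀ zero_le_one (cos_sq_le_one x) hm (le_truncCos m t)
  · rw [abs_mul, abs_mul, abs_of_pos hw, abs_of_nonneg (sq_nonneg (sin x))]
    calc |l| * truncCos m t * sin x ^ 2 ≤ |l| * 1 * 1 := by
          gcongr
          · exact truncCos_le_one hm1 t
          · exact sin_sq_le_one x
      _ = |l| := by ring

/-- A Lipschitz constant for `pruferField` in the angle. -/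
def pruferLip (m l : ℝ) : NNReal := (1 / m + |l|).toNNReal

lemma pruferField_lipschitz {m : ℝ} (hm : 0 < m) (hm1 : m ≤ 1) (l t : ℝ) :
    LipschitzWith (pruferLip m l) (pruferField m l t) := by
  have hw := truncCos_pos hm t
  have hd : ∀ x, HasDerivAt (pruferField m l t)
      ((l * truncCos m t - 1 / truncCos m t) * sin (2 * x)) x := by
    intro x
    have := (((hasDerivAt_cos x).pow 2).div_const (truncCos m t)).add
      (((hasDerivAt_sin x).pow 2).const_mul (l * truncCos m t))
    refine HasDerivAt.congr_deriv this ?_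
    rw [sin_two_mul]; push_cast; ring
  refine lipschitzWith_of_nnnorm_deriv_le (fun x => (hd x).differentiableAt) fun x => ?_
  rw [(hd x).deriv, ← NNReal.coe_le_coe, coe_nnnorm, pruferLip,
    Real.coe_toNNReal _ (by positivity), norm_mul, Real.norm_eq_abs, Real.norm_eq_abs]
  have h1 : |l * truncCos m t - 1 / truncCos m t| ≤ 1 / m + |l| := by
    refine (abs_sub _ _).trans ?_
    rw [abs_mul, abs_of_pos hw, abs_of_pos (one_div_pos.2 hw), add_comm]
    gcongr
    · exact le_truncCos m t
    · exact mul_le_of_le_one_right (abs_nonneg l) (truncCos_le_one hm1 t)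
  calc _ ≤ |l * truncCos m t - 1 / truncCos m t| * 1 := by
        gcongr; exact abs_sin_le_one _
    _ ≤ _ := by linarith

/-- `θ` solves the Prüfer angle equation on `(-2, 2)`. -/
def IsPrufer (m l : ℝ) (θ : ℝ → ℝ) : Prop :=
  ∀ t ∈ Ioo (-2 : ℝ) 2, HasDerivAt θ (pruferField m l t (θ t)) t

lemma IsPrufer.exists {m : ℝ} (hm : 0 < m) (hm1 : m ≤ 1) (l α : ℝ) :
    ∃ θ : ℝ → ℝ, θ 0 = α ∧ IsPrufer m l θ := by
  have h0 : (0 : ℝ) ∈ Icc (-2 : ℝ) 2 := by constructor <;> norm_num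
  have hpl : IsPicardLindelof (pruferField m l) (⟨0, h0⟩ : Icc (-2 : ℝ) 2) α
      (pruferLip m l * 2) 0 (pruferLip m l) (pruferLip m l) := by
    refine ⟨fun t _ => (pruferField_lipschitz hm hm1 l t).lipschitzOnWith, fun x _ => ?_,
      fun t _ x _ => ?_, ?_⟩
    · refine Continuous.continuousOn ?_
      unfold pruferField
      have := truncCos_continuous m
      exact (continuous_const.div this fun t => (truncCos_pos hm t).ne').add (by fun_prop)
    · rw [Real.norm_eq_abs, pruferLip, Real.coe_toNNReal _ (by positivity)]
      exact abs_pruferField_le hm hm1 l t x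
    · simp
  obtain ⟨θ, hθ0, hθ⟩ := hpl.exists_eq_forall_mem_Icc_hasDerivWithinAt₀
  exact ⟨θ, hθ0, fun t ht => (hθ t (Ioo_subset_Icc_self ht)).hasDerivAt (Icc_mem_nhds ht.1 ht.2)⟩

lemma IsPrufer.eqOn {m l : ℝ} (hm : 0 < m) (hm1 : m ≤ 1) {θ η : ℝ → ℝ} (hθ : IsPrufer m l θ)
    (hη : IsPrufer m l η) {c : ℝ} (hc : c ∈ Ioo (-2 : ℝ) 2) (h : θ c = η c) :
    EqOn θ η (Ioo (-2) 2) :=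
  ODE_solution_unique_of_mem_Ioo (v := pruferField m l) (s := fun _ => univ)
    (fun t _ => (pruferField_lipschitz hm hm1 l t).lipschitzOnWith) hc
    (fun t ht => ⟨hθ t ht, trivial⟩) (fun t ht => ⟨hη t ht, trivial⟩) h

lemma IsPrufer.continuousOn {m l : ℝ} {θ : ℝ → ℝ} (hθ : IsPrufer m l θ) :
    ContinuousOn θ (Ioo (-2) 2) :=
  fun t ht => (hθ t ht).continuousAt.continuousWithinAt

lemma IsPrufer.reflect {m l : ℝ} {θ : ℝ → ℝ} (hθ : IsPrufer m l θ) {c : ℝ}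
    (hc : c = 0 ∨ c = π) : IsPrufer m l (fun t => c - θ (-t)) := by
  intro t ht
  have ht' : -t ∈ Ioo (-2 : ℝ) 2 := ⟨by linarith [ht.2], by linarith [ht.1]⟩
  have h1 := ((hθ (-t) ht').scomp t (hasDerivAt_neg t)).const_sub c
  refine h1.congr_deriv ?_
  rcases hc with rfl | rfl <;> simp [pruferField, truncCos_neg]

lemma IsPrufer.dist_le {m l k : ℝ} (hm : 0 < m) (hm1 : m ≤ 1) {θ η : ℝ → ℝ}
    (hθ : IsPrufer m l θ) (hη : IsPrufer m k η) {a : ℝ} (ha0 : 0 ≤ a) (ha : a < 2) :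
    dist (η a) (θ a) ≤ gronwallBound (dist (η 0) (θ 0)) (pruferLip m l) |k - l| a := by
  have hsub : Icc 0 a ⊆ Ioo (-2 : ℝ) 2 := fun t ht => ⟨by linarith [ht.1], by linarith [ht.2]⟩
  have key := dist_le_of_approx_trajectories_ODE (v := pruferField m l) (f := η) (g := θ)
    (f' := fun t => pruferField m k t (η t)) (g' := fun t => pruferField m l t (θ t))
    (εf := |k - l|) (εg := 0) (δ := dist (η 0) (θ 0)) (a := 0) (b := a)
    (fun t => pruferField_lipschitz hm hm1 l t) (hη.continuousOn.mono hsub)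
    (fun t ht => (hη t (hsub (Ico_subset_Icc_self ht))).hasDerivWithinAt) ?_
    (hθ.continuousOn.mono hsub)
    (fun t ht => (hθ t (hsub (Ico_subset_Icc_self ht))).hasDerivWithinAt)
    (fun t _ => (dist_self _).le) le_rfl
    a ⟨ha0, le_rfl⟩
  · simpa using key
  · intro t _
    have hw := truncCos_pos hm t
    rw [Real.dist_eq, show pruferField m k t (η t) - pruferField m l t (η t)
      = (k - l) * (truncCos m t * sin (η t) ^ 2) by unfold pruferField; ring, abs_mul,
      abs_of_nonneg (show 0 ≤ truncCos m t * sin (η t) ^ 2 by positivity)]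
    exact mul_le_of_le_one_right (abs_nonneg _)
      (mul_le_one₀ (truncCos_le_one hm1 t) (sq_nonneg _) (sin_sq_le_one _))

lemma prufer_flow_continuous {m : ℝ} (hm : 0 < m) (hm1 : m ≤ 1) {Θ : ℝ → ℝ → ℝ → ℝ}
    (h0 : ∀ l α, Θ l α 0 = α) (hΘ : ∀ l α, IsPrufer m l (Θ l α)) {a : ℝ} (ha0 : 0 ≤ a)
    (ha : a < 2) : Continuous fun p : ℝ × ℝ => Θ p.1 p.2 a := by
  rw [continuous_iff_continuousAt]
  rintro ⟨l, α⟩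
  rw [ContinuousAt, tendsto_iff_dist_tendsto_zero]
  have hK : (pruferLip m l : ℝ) ≠ 0 := by
    rw [pruferLip, Real.coe_toNNReal _ (by positivity)]; positivity
  have hlim : Filter.Tendsto (fun p : ℝ × ℝ => gronwallBound (dist p.2 α) (pruferLip m l)
      |p.1 - l| a) (nhds (l, α)) (nhds 0) := by
    simp only [gronwallBound_of_K_ne_0 hK]
    refine Continuous.tendsto' (by fun_prop) _ _ (by simp)
  refine squeeze_zero (fun _ => dist_nonneg) (fun p => ?_) hlim
  simpa [h0] using (hΘ l α).dist_le hm hm1 (hΘ p.1 p.2) ha0 ha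

lemma IsPrufer.monotoneOn {m l : ℝ} (hm : 0 < m) (hl : 0 ≤ l) {θ : ℝ → ℝ} (hθ : IsPrufer m l θ) :
    MonotoneOn θ (Ioo (-2) 2) := by
  refine monotoneOn_of_deriv_nonneg (convex_Ioo _ _) hθ.continuousOn ?_ ?_
  · rw [interior_Ioo]
    exact fun t ht => (hθ t ht).differentiableAt.differentiableWithinAt
  · rw [interior_Ioo]
    intro t ht
    rw [(hθ t ht).deriv]
    exact pruferField_nonneg hm hl _ _

lemma IsPrufer.strictMonoOn {m l : ℝ} (hm : 0 < m) (hl : 0 < l) {θ : ℝ → ℝ}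
    (hθ : IsPrufer m l θ) : StrictMonoOn θ (Ioo (-2) 2) := by
  refine strictMonoOn_of_deriv_pos (convex_Ioo _ _) hθ.continuousOn ?_
  rw [interior_Ioo]
  intro t ht
  rw [(hθ t ht).deriv]
  exact pruferField_pos hm hl _ _

/-- Picone's inequality for a Prüfer angle staying in `(0, π)`. -/
lemma IsPrufer.picone {m l a : ℝ} (hm : 0 < m) (hl : 0 ≤ l) (ha0 : 0 < a) (ha : a < 2)
    {θ : ℝ → ℝ} (hθ : IsPrufer m l θ) (h0 : 0 < θ 0) (h1 : θ a < π) {f f' : ℝ → ℝ}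
    (hf : ContinuousOn f (Icc 0 a)) (hf' : ∀ t ∈ Ioo 0 a, HasDerivAt f (f' t) t) (hfa : f a = 0)
    (hf0 : f 0 = 0 ∨ cos (θ 0) = 0)
    (hfi : IntervalIntegrable (fun t => f' t ^ 2 * truncCos m t) MeasureTheory.volume 0 a) :
    l * (∫ t in (0 : ℝ)..a, f t ^ 2 * truncCos m t) ≤
      ∫ t in (0 : ℝ)..a, f' t ^ 2 * truncCos m t := by
  have hsub : Icc 0 a ⊆ Ioo (-2 : ℝ) 2 := fun t ht => ⟨by linarith [ht.1], by linarith [ht.2]⟩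
  have hsin : ∀ t ∈ Icc 0 a, 0 < sin (θ t) := by
    intro t ht
    have hmon := hθ.monotoneOn hm hl
    refine sin_pos_of_pos_of_lt_pi (h0.trans_le ?_) (lt_of_le_of_lt ?_ h1)
    · exact hmon (hsub ⟨le_rfl, ha0.le⟩) (hsub ht) ht.1
    · exact hmon (hsub ht) (hsub ⟨ha0.le, le_rfl⟩) ht.2
  have hθc : ContinuousOn θ (Icc 0 a) := hθ.continuousOn.mono hsub
  have hw := truncCos_continuous m
  have hgi : IntervalIntegrable (fun t => f t ^ 2 * truncCos m t) MeasureTheory.volume 0 a := by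
    refine ContinuousOn.intervalIntegrable ?_
    rw [uIcc_of_le ha0.le]
    exact (hf.pow 2).mul hw.continuousOn
  have key := intervalIntegral.sub_le_integral_of_hasDeriv_right_of_le (a := 0) (b := a)
    (g := fun t => cos (θ t) / sin (θ t) * f t ^ 2)
    (g' := fun t => -(pruferField m l t (θ t)) / sin (θ t) ^ 2 * f t ^ 2 +
      cos (θ t) / sin (θ t) * (2 * f t * f' t))
    (φ := fun t => f' t ^ 2 * truncCos m t - l * (f t ^ 2 * truncCos m t))
    ha0.le ?_ ?_ ?_ ?_
  · rw [intervalIntegral.integral_sub hfi (hgi.const_mul l),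
      intervalIntegral.integral_const_mul] at key
    have e0 : cos (θ 0) / sin (θ 0) * f 0 ^ 2 = 0 := by
      rcases hf0 with h | h <;> rw [h] <;> simp
    have ea : cos (θ a) / sin (θ a) * f a ^ 2 = 0 := by rw [hfa]; simp
    simp only [e0, ea] at key
    linarith
  · refine ContinuousOn.mul (ContinuousOn.div ?_ ?_ fun t ht => (hsin t ht).ne') (hf.pow 2)
    · exact continuous_cos.comp_continuousOn hθc
    · exact continuous_sin.comp_continuousOn hθc
  · intro t ht
    have ht' := Ioo_subset_Icc_self ht
    have hd := hθ t (hsub ht')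
    refine HasDerivAt.hasDerivWithinAt ?_
    refine (((hd.cos.div hd.sin (hsin t ht').ne').mul ((hf' t ht).pow 2))).congr_deriv ?_
    have := (hsin t ht').ne'
    have h1 : cos (θ t) ^ 2 = 1 - sin (θ t) ^ 2 := by rw [cos_sq']
    simp only [Pi.div_apply, Pi.pow_apply]
    push_cast
    field_simp
    ring_nf
    rw [h1]
    ring
  · exact (intervalIntegrable_iff_integrableOn_Icc_of_le ha0.le).1 (hfi.sub (hgi.const_mul l))
  · intro t ht
    have ht' := Ioo_subset_Icc_self ht
    have hs := hsin t ht'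
    have hwt := truncCos_pos hm t
    have : f' t ^ 2 * truncCos m t - l * (f t ^ 2 * truncCos m t) -
        (-(pruferField m l t (θ t)) / sin (θ t) ^ 2 * f t ^ 2 +
          cos (θ t) / sin (θ t) * (2 * f t * f' t)) =
        truncCos m t * (f' t - cos (θ t) / sin (θ t) * f t / truncCos m t) ^ 2 := by
      unfold pruferField
      field_simp
      ring
    have h2 : 0 ≤ truncCos m t * (f' t - cos (θ t) / sin (θ t) * f t / truncCos m t) ^ 2 := by
      positivity
    linarith

/-- The shooting data on `[0, a]`: Prüfer angles for every parameter and every initial angle. -/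
structure PruferFlow (m : ℝ) (Θ : ℝ → ℝ → ℝ → ℝ) : Prop where
  pos : 0 < m
  le_one : m ≤ 1
  init : ∀ l α, Θ l α 0 = α
  sol : ∀ l α, IsPrufer m l (Θ l α)

lemma PruferFlow.picone {m l a α : ℝ} {Θ : ℝ → ℝ → ℝ → ℝ} (F : PruferFlow m Θ) (hl : 0 ≤ l)
    (ha0 : 0 < a) (ha : a < 2) (hα : α = 0 ∨ α = π / 2) (h1 : Θ l α a < π) {f f' : ℝ → ℝ}
    (hf : ContinuousOn f (Icc 0 a)) (hf' : ∀ t ∈ Ioo 0 a, HasDerivAt f (f' t) t) (hfa : f a = 0)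
    (hf0 : α = 0 → f 0 = 0)
    (hfi : IntervalIntegrable (fun t => f' t ^ 2 * truncCos m t) MeasureTheory.volume 0 a) :
    l * (∫ t in (0 : ℝ)..a, f t ^ 2 * truncCos m t) ≤
      ∫ t in (0 : ℝ)..a, f' t ^ 2 * truncCos m t := by
  rcases hα with rfl | rfl
  · have hc : Continuous fun β => Θ l β a :=
      (prufer_flow_continuous F.pos F.le_one F.init F.sol ha0.le ha).comp
        (continuous_const.prodMk continuous_id)
    have hev : ∀ᶠ β in nhdsWithin 0 (Ioi 0), Θ l β a < π :=
      (hc.continuousAt.eventually (gt_mem_nhds h1)).filter_mono nhdsWithin_le_nhds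
    obtain ⟨β, hβ, hβ0⟩ := (hev.and self_mem_nhdsWithin).exists
    exact (F.sol l β).picone F.pos hl ha0 ha (by rw [F.init]; exact hβ0) hβ hf hf' hfa
      (Or.inl (hf0 rfl)) hfi
  · exact (F.sol l _).picone F.pos hl ha0 ha (by rw [F.init]; positivity) h1 hf hf' hfa
      (Or.inr (by rw [F.init, cos_pi_div_two])) hfi

lemma PruferFlow.zero_lt_pi {m a α : ℝ} {Θ : ℝ → ℝ → ℝ → ℝ} (F : PruferFlow m Θ)
    (ha0 : 0 < a) (ha : a < 2) (hα : α = 0 ∨ α = π / 2) : Θ 0 α a < π := by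
  have hpi := pi_pos
  have hconst : IsPrufer m 0 fun _ => π / 2 := fun t _ => by
    simpa [pruferField] using hasDerivAt_const t (π / 2)
  by_contra! hge
  have hsub : Icc 0 a ⊆ Ioo (-2 : ℝ) 2 := fun t ht => ⟨by linarith [ht.1], by linarith [ht.2]⟩
  obtain ⟨c, hc, hc2⟩ : π / 2 ∈ Θ 0 α '' Icc 0 a := by
    refine intermediate_value_Icc ha0.le ((F.sol 0 α).continuousOn.mono hsub) ⟨?_, by linarith⟩
    rw [F.init]; rcases hα with rfl | rfl <;> linarith
  have := (F.sol 0 α).eqOn F.pos F.le_one hconst (hsub hc) hc2 (hsub ⟨ha0.le, le_rfl⟩)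
  simp only at this
  linarith

lemma PruferFlow.exists_ge_pi {m a α : ℝ} {Θ : ℝ → ℝ → ℝ → ℝ} (F : PruferFlow m Θ)
    (ha0 : 0 < a) (ha : a < 2) (hα : α = 0 ∨ α = π / 2) : ∃ l, 0 ≤ l ∧ π ≤ Θ l α a := by
  by_contra! hlt
  have hw := truncCos_continuous m
  have hpi := pi_pos
  have hI : 0 < ∫ t in (0 : ℝ)..a, sin (π / a * t) ^ 2 * truncCos m t := by
    refine intervalIntegral.intervalIntegral_pos_of_pos_on
      (Continuous.intervalIntegrable (by fun_prop) _ _) (fun t ht => ?_) ha0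
    have h1 : 0 < sin (π / a * t) := by
      refine sin_pos_of_pos_of_lt_pi (mul_pos (by positivity) ht.1) ?_
      calc π / a * t < π / a * a := by gcongr; exact ht.2
        _ = π := by field_simp
    have := truncCos_pos F.pos t
    positivity
  set I := ∫ t in (0 : ℝ)..a, sin (π / a * t) ^ 2 * truncCos m t with hIdef
  set J := ∫ t in (0 : ℝ)..a, (cos (π / a * t) * (π / a)) ^ 2 * truncCos m t with hJdef
  have hJ : 0 ≤ J := intervalIntegral.integral_nonneg ha0.le fun t _ =>
    mul_nonneg (sq_nonneg _) (truncCos_pos F.pos t).le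
  have hl : 0 ≤ (J + 1) / I := by positivity
  have key := F.picone hl ha0 ha hα (hlt _ hl) (f := fun t => sin (π / a * t))
    (f' := fun t => cos (π / a * t) * (π / a)) (by fun_prop)
    (fun t _ => by simpa using ((hasDerivAt_id t).const_mul (π / a)).sin)
    (by simp [ha0.ne']) (by simp) (Continuous.intervalIntegrable (by fun_prop) _ _)
  rw [← hIdef, ← hJdef, div_mul_cancel₀ _ hI.ne'] at key
  linarith

/-- The first parameter at which the angle reaches `π` at the endpoint `a`. -/
lemma PruferFlow.exists_first {m a α : ℝ} {Θ : ℝ → ℝ → ℝ → ℝ} (F : PruferFlow m Θ)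
    (ha0 : 0 < a) (ha : a < 2) (hα : α = 0 ∨ α = π / 2) :
    ∃ l, 0 < l ∧ Θ l α a = π ∧ ∀ k, 0 ≤ k → k < l → Θ k α a < π := by
  have hc : Continuous fun l => Θ l α a :=
    (prufer_flow_continuous F.pos F.le_one F.init F.sol ha0.le ha).comp
      (continuous_id.prodMk continuous_const)
  set S := {l | 0 ≤ l ∧ π ≤ Θ l α a} with hS
  have hne : S.Nonempty := F.exists_ge_pi ha0 ha hα
  have hbdd : BddBelow S := ⟨0, fun l hl => hl.1⟩
  have hcl : IsClosed S := (isClosed_le continuous_const continuous_id).inter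
    (isClosed_le continuous_const hc)
  have hmem : sInf S ∈ S := hcl.csInf_mem hne hbdd
  have hlt : ∀ k, 0 ≤ k → k < sInf S → Θ k α a < π := by
    intro k hk hk2
    by_contra! h
    exact (csInf_le hbdd ⟨hk, h⟩).not_gt hk2
  obtain ⟨l, hl, hl2⟩ := intermediate_value_Icc hmem.1 hc.continuousOn
    ⟨(F.zero_lt_pi ha0 ha hα).le, hmem.2⟩
  have hle : sInf S ≤ l := csInf_le hbdd ⟨hl.1, hl2.ge⟩
  have heq : l = sInf S := le_antisymm hl.2 hle
  refine ⟨l, lt_of_le_of_ne hl.1 ?_, hl2, heq ▸ hlt⟩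
  rintro rfl
  exact (F.zero_lt_pi ha0 ha hα).ne hl2

lemma intervalIntegrable_deriv_sq_mul {a m : ℝ} (ha0 : 0 < a) {f : ℝ → ℝ}
    (hf : ContDiffOn ℝ 1 f (Icc (-a) a)) :
    IntervalIntegrable (fun t => deriv f t ^ 2 * truncCos m t) MeasureTheory.volume (-a) a := by
  have hle : -a ≤ a := by linarith
  have h1 := ((contDiffOn_one_iff_derivWithin (uniqueDiffOn_Icc (by linarith))).1 hf).2
  have h2 : IntervalIntegrable (fun t => derivWithin f (Icc (-a) a) t ^ 2 * truncCos m t)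
      MeasureTheory.volume (-a) a := by
    refine ContinuousOn.intervalIntegrable ?_
    rw [uIcc_of_le hle]
    exact (h1.pow 2).mul (truncCos_continuous m).continuousOn
  refine h2.congr_uIoo fun t ht => ?_
  rw [uIoo_of_le hle] at ht
  simp only [derivWithin_of_mem_nhds (Icc_mem_nhds ht.1 ht.2)]

lemma PruferFlow.picone_symm {m l a α : ℝ} {Θ : ℝ → ℝ → ℝ → ℝ} (F : PruferFlow m Θ) (hl : 0 ≤ l)
    (ha0 : 0 < a) (ha : a < 2) (hα : α = 0 ∨ α = π / 2) (h1 : Θ l α a < π) {f : ℝ → ℝ}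
    (hf : ContDiffOn ℝ 1 f (Icc (-a) a)) (hfa' : f (-a) = 0) (hfa : f a = 0)
    (hf0 : α = 0 → f 0 = 0) :
    l * (∫ t in (-a)..a, f t ^ 2 * truncCos m t) ≤
      ∫ t in (-a)..a, deriv f t ^ 2 * truncCos m t := by
  have hle : -a ≤ a := by linarith
  have hfi := intervalIntegrable_deriv_sq_mul (m := m) ha0 hf
  have hintR : IntervalIntegrable (fun t => deriv f t ^ 2 * truncCos m t)
      MeasureTheory.volume 0 a := by
    refine hfi.mono_set ?_
    rw [uIcc_of_le hle, uIcc_of_le ha0.le]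
    exact Icc_subset_Icc (by linarith) le_rfl
  have hintL : IntervalIntegrable (fun t => deriv f t ^ 2 * truncCos m t)
      MeasureTheory.volume (-a) 0 := by
    refine hfi.mono_set ?_
    rw [uIcc_of_le hle, uIcc_of_le (by linarith)]
    exact Icc_subset_Icc le_rfl ha0.le
  have hd : ∀ t ∈ Ioo (-a) a, HasDerivAt f (deriv f t) t := fun t ht =>
    ((hf.contDiffAt (Icc_mem_nhds ht.1 ht.2)).differentiableAt one_ne_zero).hasDerivAt
  have hfc := hf.continuousOn
  have hfint : IntervalIntegrable (fun t => f t ^ 2 * truncCos m t)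
      MeasureTheory.volume (-a) a := by
    refine ContinuousOn.intervalIntegrable ?_
    rw [uIcc_of_le hle]
    exact (hfc.pow 2).mul (truncCos_continuous m).continuousOn
  have hfintR : IntervalIntegrable (fun t => f t ^ 2 * truncCos m t)
      MeasureTheory.volume 0 a := by
    refine hfint.mono_set ?_
    rw [uIcc_of_le hle, uIcc_of_le ha0.le]
    exact Icc_subset_Icc (by linarith) le_rfl
  have hfintL : IntervalIntegrable (fun t => f t ^ 2 * truncCos m t)
      MeasureTheory.volume (-a) 0 := by
    refine hfint.mono_set ?_
    rw [uIcc_of_le hle, uIcc_of_le (by linarith)]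
    exact Icc_subset_Icc le_rfl ha0.le
  have right := F.picone hl ha0 ha hα h1 (f := f) (f' := deriv f)
    (hfc.mono (Icc_subset_Icc (by linarith) le_rfl))
    (fun t ht => hd t ⟨by linarith [ht.1], ht.2⟩) hfa hf0 hintR
  have left := F.picone hl ha0 ha hα h1 (f := fun t => f (-t)) (f' := fun t => -deriv f (-t))
    (hfc.comp continuous_neg.continuousOn
      fun t ht => ⟨by linarith [ht.2], by linarith [ht.1]⟩)
    (fun t ht => by
      have := (hd (-t) ⟨by linarith [ht.2], by linarith [ht.1]⟩).scomp t (hasDerivAt_neg t)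
      exact this.congr_deriv (by simp)) hfa' (by simpa using hf0) (by
      have := hintL.symm.comp_sub_left 0
      simpa [truncCos_neg] using this)
  have eR : (∫ t in (0 : ℝ)..a, f (-t) ^ 2 * truncCos m t) =
      ∫ t in (-a)..0, f t ^ 2 * truncCos m t := by
    have := intervalIntegral.integral_comp_neg (a := 0) (b := a)
      (fun t => f t ^ 2 * truncCos m t)
    simpa [truncCos_neg] using this
  have eL : (∫ t in (0 : ℝ)..a, (-deriv f (-t)) ^ 2 * truncCos m t) =
      ∫ t in (-a)..0, deriv f t ^ 2 * truncCos m t := by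
    have := intervalIntegral.integral_comp_neg (a := 0) (b := a)
      (fun t => deriv f t ^ 2 * truncCos m t)
    simpa [truncCos_neg] using this
  rw [eR, eL] at left
  rw [← intervalIntegral.integral_add_adjacent_intervals hintL hintR,
    ← intervalIntegral.integral_add_adjacent_intervals hfintL hfintR]
  linarith

lemma integral_sq_mul_cos_pos {a : ℝ} (ha0 : 0 < a) (ha : a < π / 2) {f : ℝ → ℝ}
    (hfc : ContinuousOn f (Icc (-a) a)) (hne : ∃ s ∈ Icc (-a) a, f s ≠ 0) :
    0 < ∫ s in (-a)..a, f s ^ 2 * cos s := by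
  have hcos : ∀ t ∈ Icc (-a) a, 0 < cos t := fun t ht =>
    cos_pos_of_mem_Ioo ⟨by linarith [ht.1], by linarith [ht.2]⟩
  obtain ⟨s, hs, hs0⟩ := hne
  refine intervalIntegral.integral_pos (by linarith) ((hfc.pow 2).mul continuous_cos.continuousOn)
    (fun t ht => mul_nonneg (sq_nonneg _) (hcos t (Ioc_subset_Icc_self ht)).le) ⟨s, hs, ?_⟩
  have := hcos s hs
  positivity

lemma PruferFlow.le_rayleighQ {m l D α : ℝ} {Θ : ℝ → ℝ → ℝ → ℝ} (F : PruferFlow m Θ) (hl : 0 ≤ l)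
    (hD0 : 0 < D) (hD : D < π) (hα : α = 0 ∨ α = π / 2)
    (hW : ∀ t ∈ Icc (-(D / 2)) (D / 2), truncCos m t = cos t)
    (h1 : Θ l α (D / 2) < π) {f : ℝ → ℝ}
    (hf : ContDiffOn ℝ 1 f (Icc (-(D / 2)) (D / 2)))
    (hne : ∃ s ∈ Icc (-(D / 2)) (D / 2), f s ≠ 0)
    (hfa' : f (-(D / 2)) = 0) (hfa : f (D / 2) = 0) (hf0 : α = 0 → f 0 = 0) :
    l ≤ rayleighQ 2 D f := by
  have h4 := pi_lt_four
  have hle : -(D / 2) ≤ D / 2 := by linarith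
  have hpos := integral_sq_mul_cos_pos (by linarith) (by linarith) hf.continuousOn hne
  have key := F.picone_symm hl (a := D / 2) (by linarith) (by linarith) hα h1 hf hfa' hfa hf0
  have e : ∀ g : ℝ → ℝ, (∫ t in (-(D / 2))..(D / 2), g t ^ 2 * truncCos m t) =
      ∫ t in (-(D / 2))..(D / 2), g t ^ 2 * cos t := by
    intro g
    refine intervalIntegral.integral_congr fun t ht => ?_
    rw [uIcc_of_le hle] at ht
    simp only [hW t ht]
  rw [e, e] at key
  rw [rayleighQ, le_div_iff₀ (by simpa using hpos)]
  simpa using key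

/-- The pair `(u, d)` solves `u' = d`, `d' = tan s * d - l * u` at `s`. -/
def SolvesAt (l : ℝ) (u d : ℝ → ℝ) (s : ℝ) : Prop :=
  HasDerivAt u (d s) s ∧ HasDerivAt d (tan s * d s - l * u s) s

lemma rayleighQ_eq_of_solvesAt {l D : ℝ} (hD0 : 0 < D) (hD : D < π) {u d : ℝ → ℝ}
    (h : ∀ s ∈ Icc (-(D / 2)) (D / 2), SolvesAt l u d s)
    (hne : ∃ s ∈ Icc (-(D / 2)) (D / 2), u s ≠ 0)
    (hu' : u (-(D / 2)) = 0) (hu : u (D / 2) = 0) : rayleighQ 2 D u = l := by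
  have hle : -(D / 2) ≤ D / 2 := by linarith
  have hcos : ∀ t ∈ Icc (-(D / 2)) (D / 2), cos t ≠ 0 := fun t ht =>
    (cos_pos_of_mem_Ioo ⟨by linarith [ht.1], by linarith [ht.2]⟩).ne'
  have hu_cont : ContinuousOn u (Icc (-(D / 2)) (D / 2)) :=
    fun t ht => (h t ht).1.continuousAt.continuousWithinAt
  have hd_cont : ContinuousOn d (Icc (-(D / 2)) (D / 2)) :=
    fun t ht => (h t ht).2.continuousAt.continuousWithinAt
  have hpos := integral_sq_mul_cos_pos (by linarith) (by linarith) hu_cont hne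
  have i1 : IntervalIntegrable (fun s => d s ^ 2 * cos s) MeasureTheory.volume
      (-(D / 2)) (D / 2) := by
    refine ContinuousOn.intervalIntegrable ?_
    rw [uIcc_of_le hle]
    exact (hd_cont.pow 2).mul continuous_cos.continuousOn
  have i2 : IntervalIntegrable (fun s => u s ^ 2 * cos s) MeasureTheory.volume
      (-(D / 2)) (D / 2) := by
    refine ContinuousOn.intervalIntegrable ?_
    rw [uIcc_of_le hle]
    exact (hu_cont.pow 2).mul continuous_cos.continuousOn
  have key := intervalIntegral.integral_eq_sub_of_hasDerivAt_of_le hle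
    (f := fun s => u s * d s * cos s)
    (f' := fun s => d s ^ 2 * cos s - l * (u s ^ 2 * cos s))
    ((hu_cont.mul hd_cont).mul continuous_cos.continuousOn)
    (fun s hs => by
      have hs' := Ioo_subset_Icc_self hs
      have := hcos s hs'
      refine (((h s hs').1.mul (h s hs').2).mul (hasDerivAt_cos s)).congr_deriv ?_
      rw [tan_eq_sin_div_cos]
      simp only [Pi.mul_apply]
      field_simp
      ring) (i1.sub (i2.const_mul l))
  rw [intervalIntegral.integral_sub i1 (i2.const_mul l),
    intervalIntegral.integral_const_mul] at key
  simp only [hu, hu', zero_mul, sub_zero] at key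
  have e : (∫ s in (-(D / 2))..(D / 2), deriv u s ^ 2 * cos s) =
      ∫ s in (-(D / 2))..(D / 2), d s ^ 2 * cos s := by
    refine intervalIntegral.integral_congr fun t ht => ?_
    rw [uIcc_of_le hle] at ht
    simp only [(h t ht).1.deriv]
  simp only [rayleighQ, Nat.add_one_sub_one, pow_one, e]
  rw [div_eq_iff hpos.ne']
  linarith

lemma contDiffOn_of_solvesAt {l a b : ℝ} (hab : a < b) {u d : ℝ → ℝ}
    (h : ∀ s ∈ Icc a b, SolvesAt l u d s) : ContDiffOn ℝ 1 u (Icc a b) := by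
  have hu := uniqueDiffOn_Icc hab
  rw [contDiffOn_one_iff_derivWithin hu]
  refine ⟨fun s hs => (h s hs).1.differentiableAt.differentiableWithinAt, ?_⟩
  refine ContinuousOn.congr (f := d) (fun s hs => (h s hs).2.continuousAt.continuousWithinAt) ?_
  exact fun s hs => (h s hs).1.hasDerivWithinAt.derivWithin (hu s hs)

/-- The amplitude turning a Prüfer angle into a solution of the linear equation. -/
lemma IsPrufer.exists_amplitude {m l : ℝ} (hm : 0 < m) {θ : ℝ → ℝ} (hθ : IsPrufer m l θ) :
    ∃ r : ℝ → ℝ, (∀ t, 0 < r t) ∧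
      (∀ t ∈ Ioo (-2 : ℝ) 2,
        HasDerivAt (fun s => r s * sin (θ s)) (r t * cos (θ t) / truncCos m t) t ∧
        HasDerivAt (fun s => r s * cos (θ s)) (-(l * truncCos m t * (r t * sin (θ t)))) t) ∧
      ((∀ t ∈ Ioo (-2 : ℝ) 2, θ (-t) = -θ t) → ∀ t ∈ Ioo (-2 : ℝ) 2, r (-t) = r t) := by
  set g : ℝ → ℝ := fun t =>
    sin (θ t) * cos (θ t) * (1 / truncCos m t - l * truncCos m t) with hg
  have hwc := truncCos_continuous m
  have hgc : ContinuousOn g (Ioo (-2) 2) := by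
    have h1 := continuous_sin.comp_continuousOn hθ.continuousOn
    have h2 := continuous_cos.comp_continuousOn hθ.continuousOn
    have h3 : Continuous fun t => 1 / truncCos m t - l * truncCos m t :=
      (continuous_const.div hwc fun t => (truncCos_pos hm t).ne').sub (by fun_prop)
    exact (h1.mul h2).mul h3.continuousOn
  have hgi : ∀ t ∈ Ioo (-2 : ℝ) 2, HasDerivAt (fun s => ∫ x in (0 : ℝ)..s, g x) (g t) t := by
    intro t ht
    have hnh : Ioo (-2 : ℝ) 2 ∈ nhds t := isOpen_Ioo.mem_nhds ht
    refine intervalIntegral.integral_hasDerivAt_right ?_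
      (hgc.stronglyMeasurableAtFilter isOpen_Ioo t ht) (hgc.continuousAt hnh)
    refine (hgc.mono fun x hx => ?_).intervalIntegrable
    exact (ordConnected_Ioo.uIcc_subset (by constructor <;> norm_num) ht) hx
  refine ⟨fun t => exp (∫ x in (0 : ℝ)..t, g x), fun t => exp_pos _, fun t ht => ?_, ?_⟩
  · have hr := (hgi t ht).exp
    have hw := (truncCos_pos hm t).ne'
    have h1 : cos (θ t) ^ 2 = 1 - sin (θ t) ^ 2 := cos_sq' _
    constructor
    · refine (hr.mul (hθ t ht).sin).congr_deriv ?_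
      beta_reduce
      generalize exp (∫ x in (0 : ℝ)..t, g x) = R
      simp only [hg, pruferField]
      field_simp
      rw [h1]
      ring
    · refine (hr.mul (hθ t ht).cos).congr_deriv ?_
      beta_reduce
      generalize exp (∫ x in (0 : ℝ)..t, g x) = R
      simp only [hg, pruferField]
      field_simp
      rw [h1]
      ring
  · intro hodd t ht
    have h1 := intervalIntegral.integral_comp_neg (a := 0) (b := t) g
    have h2 : (∫ x in (0 : ℝ)..t, g (-x)) = -∫ x in (0 : ℝ)..t, g x := by
      rw [← intervalIntegral.integral_neg]
      refine intervalIntegral.integral_congr fun x hx => ?_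
      have hx' := (ordConnected_Ioo.uIcc_subset (show (0 : ℝ) ∈ Ioo (-2 : ℝ) 2 by
        constructor <;> norm_num) ht) hx
      simp only [hg, hodd x hx', truncCos_neg, sin_neg, cos_neg]
      ring
    simp only
    rw [intervalIntegral.integral_symm, ← neg_zero, ← h1, neg_zero, h2, neg_neg]

lemma truncCos_eq_cos {a : ℝ} (ha : a ≤ π) {t : ℝ} (ht : t ∈ Icc (-a) a) :
    truncCos (cos a) t = cos t := by
  refine max_eq_left ?_
  rw [← cos_abs t]
  exact cos_le_cos_of_nonneg_of_le_pi (abs_nonneg t) ha (abs_le.2 ht)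

lemma exists_minimizer {D α : ℝ} (hD0 : 0 < D) (hD : D < π) (hα : α = 0 ∨ α = π / 2) :
    ∃ (l : ℝ) (u d : ℝ → ℝ), (∀ s ∈ Icc (-(D / 2)) (D / 2), SolvesAt l u d s) ∧
      (∀ s ∈ Ioo 0 (D / 2), 0 < u s) ∧ u (D / 2) = 0 ∧ u (-(D / 2)) = 0 ∧ d (D / 2) < 0 ∧
      (α = 0 → u 0 = 0 ∧ 0 < d 0 ∧ ∀ s ∈ Icc (-(D / 2)) (D / 2), u (-s) = -u s) ∧
      (α = π / 2 → 0 < u 0 ∧ d 0 = 0) ∧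
      ∀ f : ℝ → ℝ, ContDiffOn ℝ 1 f (Icc (-(D / 2)) (D / 2)) →
        (∃ s ∈ Icc (-(D / 2)) (D / 2), f s ≠ 0) → f (-(D / 2)) = 0 → f (D / 2) = 0 →
        (α = 0 → f 0 = 0) → l ≤ rayleighQ 2 D f := by
  have hpi := pi_pos
  have h4 := pi_lt_four
  have ha0 : 0 < D / 2 := by linarith
  have ha2 : D / 2 < 2 := by linarith
  have hsub : Icc (-(D / 2)) (D / 2) ⊆ Ioo (-2 : ℝ) 2 :=
    fun t ht => ⟨by linarith [ht.1], by linarith [ht.2]⟩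
  have hm : 0 < cos (D / 2) := cos_pos_of_mem_Ioo ⟨by linarith, by linarith⟩
  have hm1 := cos_le_one (D / 2)
  have hW : ∀ t ∈ Icc (-(D / 2)) (D / 2), truncCos (cos (D / 2)) t = cos t :=
    fun t ht => truncCos_eq_cos (by linarith) ht
  choose Θ hΘ0 hΘ using IsPrufer.exists hm hm1
  have F : PruferFlow (cos (D / 2)) Θ := ⟨hm, hm1, hΘ0, hΘ⟩
  obtain ⟨l, hl, hla, hlt⟩ := F.exists_first ha0 ha2 hα
  have hθ := hΘ l α
  have hθ0 := hΘ0 l α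
  set θ := Θ l α
  obtain ⟨r, hr, hode, hrodd⟩ := hθ.exists_amplitude hm
  have h0mem : (0 : ℝ) ∈ Icc (-(D / 2)) (D / 2) := ⟨by linarith, by linarith⟩
  have hamem : D / 2 ∈ Icc (-(D / 2)) (D / 2) := ⟨by linarith, by linarith⟩
  have hrefl : ∀ t ∈ Ioo (-2 : ℝ) 2, θ (-t) = 2 * α - θ t := by
    have hc : 2 * α = 0 ∨ 2 * α = π := by
      rcases hα with rfl | rfl
      · left; ring
      · right; ring
    have := hθ.eqOn hm hm1 (hθ.reflect hc) (hsub h0mem)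
      (by simp only [neg_zero, hθ0]; ring)
    intro t ht
    have h1 := this ht
    simp only at h1
    linarith
  have hcos : ∀ t ∈ Icc (-(D / 2)) (D / 2), 0 < cos t := fun t ht =>
    cos_pos_of_mem_Ioo ⟨by linarith [ht.1], by linarith [ht.2]⟩
  refine ⟨l, fun s => r s * sin (θ s), fun s => r s * cos (θ s) / cos s, ?_, ?_, ?_, ?_, ?_, ?_,
    ?_, ?_⟩
  · intro s hs
    have hc := (hcos s hs).ne'
    obtain ⟨h1, h2⟩ := hode s (hsub hs)
    rw [hW s hs] at h1 h2
    refine ⟨h1, (h2.div (hasDerivAt_cos s) hc).congr_deriv ?_⟩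
    rw [tan_eq_sin_div_cos]
    field_simp
    ring
  · intro s hs
    have hmon := hθ.strictMonoOn hm hl
    have hs' : s ∈ Ioo (-2 : ℝ) 2 := hsub ⟨by linarith [hs.1], hs.2.le⟩
    have h1 := hmon (hsub h0mem) hs' hs.1
    have h2 := hmon hs' (hsub hamem) hs.2
    refine mul_pos (hr s) (sin_pos_of_pos_of_lt_pi ?_ (by linarith))
    rcases hα with rfl | rfl <;> linarith
  · simp [hla]
  · have : θ (-(D / 2)) = 2 * α - π := by rw [hrefl _ (hsub hamem), hla]
    simp only [this]
    rcases hα with rfl | rfl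
    · simp
    · simp [mul_div_cancel₀]
  · simp only [hla, cos_pi]
    exact div_neg_of_neg_of_pos (by linarith [hr (D / 2)]) hm
  · rintro rfl
    refine ⟨by simp [hθ0], by simp [hθ0, hr], fun s hs => ?_⟩
    have hodd : ∀ t ∈ Ioo (-2 : ℝ) 2, θ (-t) = -θ t := fun t ht => by rw [hrefl t ht]; ring
    simp only [hrodd hodd s (hsub hs), hodd s (hsub hs), sin_neg]
    ring
  · rintro rfl
    simp [hθ0, hr]
  · intro f hf hne hfa' hfa hf0
    refine le_of_forall_lt_imp_le_of_dense fun k hk => ?_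
    have h1 : ∀ k, 0 ≤ k → k < l → k ≤ rayleighQ 2 D f := fun k hk0 hk =>
      F.le_rayleighQ hk0 hD0 hD hα hW (hlt k hk0 hk) hf hne hfa' hfa hf0
    rcases le_total 0 k with h | h
    · exact h1 k h hk
    · exact h.trans (h1 0 le_rfl hl)

lemma exists_modelLam1_eigenfunction {D : ℝ} (hD0 : 0 < D) (hD : D < π) :
    ∃ u d : ℝ → ℝ, (∀ s ∈ Icc 0 (D / 2), SolvesAt (modelLam1 2 D) u d s) ∧
      (∀ s ∈ Ico 0 (D / 2), 0 < u s) ∧ d 0 = 0 ∧ u (D / 2) = 0 ∧ d (D / 2) < 0 := by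
  obtain ⟨l, u, d, hode, hpos, hua, hua', hda, -, h0, hmin⟩ :=
    exists_minimizer hD0 hD (Or.inr rfl)
  obtain ⟨hu0, hd0⟩ := h0 rfl
  have hne : ∃ s ∈ Icc (-(D / 2)) (D / 2), u s ≠ 0 :=
    ⟨0, ⟨by linarith, by linarith⟩, hu0.ne'⟩
  have hlam : modelLam1 2 D = l := by
    refine IsLeast.csInf_eq ⟨⟨u, ⟨?_, hne, hua', hua⟩, ?_⟩, ?_⟩
    · exact contDiffOn_of_solvesAt (by linarith) hode
    · exact rayleighQ_eq_of_solvesAt hD0 hD hode hne hua' hua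
    · rintro _ ⟨f, ⟨hf, hfne, hfa', hfa⟩, rfl⟩
      exact hmin f hf hfne hfa' hfa fun h => absurd h (by positivity)
  refine ⟨u, d, fun s hs => ?_, fun s hs => ?_, hd0, hua, hda⟩
  · rw [hlam]
    exact hode s ⟨by linarith [hs.1], hs.2⟩
  · rcases hs.1.eq_or_lt with rfl | h
    · exact hu0
    · exact hpos s ⟨h, hs.2⟩

lemma exists_modelLam2_eigenfunction {D : ℝ} (hD0 : 0 < D) (hD : D < π) :
    ∃ u d : ℝ → ℝ, (∀ s ∈ Icc 0 (D / 2), SolvesAt (modelLam2 2 D) u d s) ∧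
      (∀ s ∈ Ioo 0 (D / 2), 0 < u s) ∧ u 0 = 0 ∧ 0 < d 0 ∧ u (D / 2) = 0 := by
  obtain ⟨l, u, d, hode, hpos, hua, hua', -, h0, -, hmin⟩ :=
    exists_minimizer hD0 hD (Or.inl rfl)
  obtain ⟨hu0, hd0, hodd⟩ := h0 rfl
  have hne : ∃ s ∈ Icc (-(D / 2)) (D / 2), u s ≠ 0 :=
    ⟨D / 4, ⟨by linarith, by linarith⟩, (hpos _ ⟨by linarith, by linarith⟩).ne'⟩
  have hlam : modelLam2 2 D = l := by
    refine IsLeast.csInf_eq ⟨⟨u, ⟨?_, hne, hodd, hua', hua⟩, ?_⟩, ?_⟩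
    · exact contDiffOn_of_solvesAt (by linarith) hode
    · exact rayleighQ_eq_of_solvesAt hD0 hD hode hne hua' hua
    · rintro _ ⟨f, ⟨hf, hfne, hfodd, hfa', hfa⟩, rfl⟩
      refine hmin f hf hfne hfa' hfa fun _ => ?_
      have := hfodd 0 ⟨by linarith, by linarith⟩
      rw [neg_zero] at this
      linarith
  refine ⟨u, d, fun s hs => ?_, hpos, hu0, hd0, hua⟩
  rw [hlam]
  exact hode s ⟨by linarith [hs.1], hs.2⟩

/-- The drift `a * tan (a * x)` of the model operator rescaled to the unit interval. -/
def drift (a x : ℝ) : ℝ := a * tan (a * x)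

lemma cos_mul_pos {a x : ℝ} (ha0 : 0 < a) (ha : a < π / 2) (hx : x ∈ Icc (0 : ℝ) 1) :
    0 < cos (a * x) := by
  have h1 : 0 ≤ a * x := mul_nonneg ha0.le hx.1
  have h2 : a * x ≤ a := mul_le_of_le_one_right ha0.le hx.2
  exact cos_pos_of_mem_Ioo ⟨by linarith, by linarith⟩

lemma hasDerivAt_drift {a x : ℝ} (h : cos (a * x) ≠ 0) :
    HasDerivAt (drift a) (a ^ 2 + drift a x ^ 2) x := by
  have h1 := ((Real.hasDerivAt_tan h).comp x ((hasDerivAt_id x).const_mul a)).const_mul a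
  refine h1.congr_deriv ?_
  have h2 : sin (a * x) ^ 2 = 1 - cos (a * x) ^ 2 := sin_sq _
  simp only [drift, tan_eq_sin_div_cos]
  field_simp
  rw [h2]
  ring

lemma hasDerivAt_cos_mul {a x : ℝ} (h : cos (a * x) ≠ 0) :
    HasDerivAt (fun y => cos (a * y)) (-(drift a x * cos (a * x))) x := by
  refine (((hasDerivAt_id x).const_mul a).cos).congr_deriv ?_
  simp only [drift, id, tan_eq_sin_div_cos]
  field_simp

lemma drift_nonneg {a x : ℝ} (ha0 : 0 < a) (ha : a < π / 2) (hx : x ∈ Icc (0 : ℝ) 1) :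
    0 ≤ drift a x := by
  have h1 : 0 ≤ a * x := mul_nonneg ha0.le hx.1
  have h2 : a * x ≤ a := mul_le_of_le_one_right ha0.le hx.2
  exact mul_nonneg ha0.le (tan_nonneg_of_nonneg_of_le_pi_div_two h1 (by linarith))

lemma drift_lt_drift {a b x : ℝ} (ha0 : 0 < a) (hab : a < b) (hb : b < π / 2)
    (hx : x ∈ Ioc (0 : ℝ) 1) : drift a x < drift b x := by
  have h1 : 0 < a * x := mul_pos ha0 hx.1
  have h2 : a * x < b * x := mul_lt_mul_of_pos_right hab hx.1
  have h3 : b * x ≤ b := mul_le_of_le_one_right (by linarith) hx.2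
  have h4 : tan (a * x) < tan (b * x) :=
    tan_lt_tan_of_nonneg_of_lt_pi_div_two h1.le (by linarith) h2
  have h5 : 0 < tan (a * x) := tan_pos_of_pos_of_lt_pi_div_two h1 (by linarith)
  exact mul_lt_mul hab h4.le h5 (by linarith)

lemma drift_sq_sub_strictMonoOn {a b : ℝ} (ha0 : 0 < a) (hab : a < b) (hb : b < π / 2) :
    StrictMonoOn (fun x => drift b x ^ 2 - drift a x ^ 2) (Icc 0 1) := by
  have hd : ∀ x ∈ Icc (0 : ℝ) 1, HasDerivAt (fun x => drift b x ^ 2 - drift a x ^ 2)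
      (2 * drift b x * (b ^ 2 + drift b x ^ 2) - 2 * drift a x * (a ^ 2 + drift a x ^ 2)) x := by
    intro x hx
    have h1 := hasDerivAt_drift (cos_mul_pos ha0 (hab.trans hb) hx).ne'
    have h2 := hasDerivAt_drift (cos_mul_pos (ha0.trans hab) hb hx).ne'
    refine ((h2.pow 2).sub (h1.pow 2)).congr_deriv ?_
    push_cast
    ring
  refine strictMonoOn_of_deriv_pos (convex_Icc _ _)
    (fun x hx => (hd x hx).continuousAt.continuousWithinAt) fun x hx => ?_
  rw [interior_Icc] at hx
  rw [(hd x (Ioo_subset_Icc_self hx)).deriv]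
  have h1 := drift_nonneg ha0 (hab.trans hb) (Ioo_subset_Icc_self hx)
  have h2 := drift_lt_drift ha0 hab hb (Ioo_subset_Ioc_self hx)
  have h3 : a ^ 2 + drift a x ^ 2 < b ^ 2 + drift b x ^ 2 := by gcongr
  have h4 : drift a x * (a ^ 2 + drift a x ^ 2) < drift b x * (b ^ 2 + drift b x ^ 2) :=
    mul_lt_mul'' h2 h3 h1 (by positivity)
  linarith

/-- The pair `(u, d)` solves `u' = d`, `d' = drift a x * d - L * u` at `x`. -/
def ScaledSolvesAt (a L : ℝ) (u d : ℝ → ℝ) (x : ℝ) : Prop :=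
  HasDerivAt u (d x) x ∧ HasDerivAt d (drift a x * d x - L * u x) x

lemma SolvesAt.scale {a l x : ℝ} {u d : ℝ → ℝ} (h : SolvesAt l u d (a * x)) :
    ScaledSolvesAt a (a ^ 2 * l) (fun y => u (a * y)) (fun y => a * d (a * y)) x := by
  have hid : HasDerivAt (fun y => a * y) a x := by simpa using (hasDerivAt_id x).const_mul a
  refine ⟨(h.1.comp x hid).congr_deriv (by ring), ((h.2.comp x hid).const_mul a).congr_deriv ?_⟩
  simp only [drift]
  ring

/-- A ground state of the rescaled model on `[0, 1]`, even about `0`. -/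
structure IsGroundState (a L : ℝ) (u d : ℝ → ℝ) : Prop where
  solves : ∀ x ∈ Icc (0 : ℝ) 1, ScaledSolvesAt a L u d x
  pos : ∀ x ∈ Ico (0 : ℝ) 1, 0 < u x
  deriv_zero : d 0 = 0
  one : u 1 = 0
  deriv_one : d 1 < 0

/-- A first excited state of the rescaled model on `[0, 1]`, odd about `0`. -/
structure IsExcitedState (a M : ℝ) (v e : ℝ → ℝ) : Prop where
  solves : ∀ x ∈ Icc (0 : ℝ) 1, ScaledSolvesAt a M v e x
  pos : ∀ x ∈ Ioo (0 : ℝ) 1, 0 < v x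
  zero : v 0 = 0
  deriv_zero : 0 < e 0
  one : v 1 = 0

lemma hasDerivAt_wronskian {a L M x : ℝ} {u d v e : ℝ → ℝ} (hu : ScaledSolvesAt a L u d x)
    (hv : ScaledSolvesAt a M v e x) :
    HasDerivAt (fun y => e y * u y - v y * d y)
      (drift a x * (e x * u x - v x * d x) - (M - L) * (u x * v x)) x := by
  refine ((hv.2.mul hu.1).sub (hv.1.mul hu.2)).congr_deriv ?_
  ring

lemma IsExcitedState.wronskian_pos {a L M : ℝ} (ha0 : 0 < a) (ha : a < π / 2) {u d v e : ℝ → ℝ}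
    (hv : IsExcitedState a M v e) (hu : IsGroundState a L u d) {x : ℝ}
    (hx : x ∈ Ioo (0 : ℝ) 1) : 0 < e x * u x - v x * d x := by
  set q : ℝ → ℝ := fun y => cos (a * y) * (e y * u y - v y * d y) with hq
  have hd : ∀ y ∈ Icc (0 : ℝ) 1,
      HasDerivAt q (-((M - L) * (cos (a * y) * (u y * v y)))) y := by
    intro y hy
    refine ((hasDerivAt_cos_mul (cos_mul_pos ha0 ha hy).ne').mul
      (hasDerivAt_wronskian (hu.solves y hy) (hv.solves y hy))).congr_deriv ?_
    ring
  have hqc : ContinuousOn q (Icc 0 1) := fun y hy => (hd y hy).continuousAt.continuousWithinAt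
  have hq1 : q 1 = 0 := by simp [hq, hu.one, hv.one]
  have hq0 : 0 < q 0 := by
    simpa [hq, hv.zero] using mul_pos hv.deriv_zero (hu.pos 0 ⟨le_rfl, one_pos⟩)
  have hcuv : ∀ y ∈ Ioo (0 : ℝ) 1, 0 < cos (a * y) * (u y * v y) := fun y hy =>
    mul_pos (cos_mul_pos ha0 ha (Ioo_subset_Icc_self hy))
      (mul_pos (hu.pos y (Ioo_subset_Ico_self hy)) (hv.pos y hy))
  have hgap : 0 < M - L := by
    by_contra! hle
    have hmono : MonotoneOn q (Icc 0 1) := by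
      refine monotoneOn_of_deriv_nonneg (convex_Icc _ _) hqc
        (fun y hy => (hd y (interior_subset hy)).differentiableAt.differentiableWithinAt)
        fun y hy => ?_
      rw [(hd y (interior_subset hy)).deriv]
      rw [interior_Icc] at hy
      nlinarith [hcuv y hy]
    have := hmono ⟨le_rfl, zero_le_one⟩ ⟨zero_le_one, le_rfl⟩ zero_le_one
    linarith
  have hanti : StrictAntiOn q (Icc 0 1) := by
    refine strictAntiOn_of_deriv_neg (convex_Icc _ _) hqc fun y hy => ?_
    rw [(hd y (interior_subset hy)).deriv]
    rw [interior_Icc] at hy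
    have := mul_pos hgap (hcuv y hy)
    linarith
  have hqx := hanti (Ioo_subset_Icc_self hx) ⟨zero_le_one, le_rfl⟩ hx.2
  rw [hq1] at hqx
  exact (pos_iff_pos_of_mul_pos hqx).1 (cos_mul_pos ha0 ha (Ioo_subset_Icc_self hx))

/-- Comparison of the logarithmic derivatives of two ground states. -/
lemma IsGroundState.log_deriv_lt {a b L₁ L₂ : ℝ} (ha0 : 0 < a) (hab : a < b) (hb : b < π / 2)
    {u₁ d₁ u₂ d₂ : ℝ → ℝ} (h₁ : IsGroundState a L₁ u₁ d₁) (h₂ : IsGroundState b L₂ u₂ d₂) {x : ℝ}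
    (hx : x ∈ Ioo (0 : ℝ) 1) :
    0 < u₁ x * d₂ x - u₂ x * d₁ x - u₁ x * u₂ x * (drift b x - drift a x) / 2 := by
  have hb0 : 0 < b := ha0.trans hab
  have ha : a < π / 2 := hab.trans hb
  set K : ℝ → ℝ := fun y =>
    L₁ - L₂ - (b ^ 2 - a ^ 2) / 2 - (drift b y ^ 2 - drift a y ^ 2) / 4 with hK
  set N : ℝ → ℝ := fun y => √(cos (a * y) * cos (b * y)) *
    (u₁ y * d₂ y - u₂ y * d₁ y - u₁ y * u₂ y * (drift b y - drift a y) / 2) with hN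
  have hKanti : StrictAntiOn K (Icc 0 1) := fun y hy z hz hyz => by
    have := drift_sq_sub_strictMonoOn ha0 hab hb hy hz hyz
    simp only at this
    simp only [hK]
    linarith
  have hcc : ∀ y ∈ Icc (0 : ℝ) 1, 0 < cos (a * y) * cos (b * y) := fun y hy =>
    mul_pos (cos_mul_pos ha0 ha hy) (cos_mul_pos hb0 hb hy)
  have hd : ∀ y ∈ Icc (0 : ℝ) 1, HasDerivAt N
      (√(cos (a * y) * cos (b * y)) * (u₁ y * u₂ y) * K y) y := by
    intro y hy
    have hca := (cos_mul_pos ha0 ha hy).ne'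
    have hcb := (cos_mul_pos hb0 hb hy).ne'
    have hs := ((hasDerivAt_cos_mul hca).mul (hasDerivAt_cos_mul hcb)).sqrt (hcc y hy).ne'
    have hs' : HasDerivAt (fun z => √(cos (a * z) * cos (b * z)))
        (-(drift a y + drift b y) / 2 * √(cos (a * y) * cos (b * y))) y := by
      refine hs.congr_deriv ?_
      have hpos := Real.sqrt_pos.2 (hcc y hy)
      have hsq := Real.sq_sqrt (hcc y hy).le
      simp only [Pi.mul_apply]
      rw [div_eq_iff (by positivity)]
      linear_combination (drift a y + drift b y) * hsq
    obtain ⟨hu1, hd1⟩ := h₁.solves y hy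
    obtain ⟨hu2, hd2⟩ := h₂.solves y hy
    refine (hs'.mul (((hu1.mul hd2).sub (hu2.mul hd1)).sub
      (((hu1.mul hu2).mul ((hasDerivAt_drift hcb).sub
        (hasDerivAt_drift hca))).div_const 2))).congr_deriv ?_
    simp only [hK, Pi.mul_apply, Pi.sub_apply]
    ring
  have hNc : ContinuousOn N (Icc 0 1) := fun y hy => (hd y hy).continuousAt.continuousWithinAt
  have hN0 : N 0 = 0 := by simp [hN, h₁.deriv_zero, h₂.deriv_zero, drift]
  have hN1 : N 1 = 0 := by simp [hN, h₁.one, h₂.one]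
  have hfac : ∀ y ∈ Ico (0 : ℝ) 1, 0 < √(cos (a * y) * cos (b * y)) * (u₁ y * u₂ y) :=
    fun y hy => mul_pos (Real.sqrt_pos.2 (hcc y (Ico_subset_Icc_self hy)))
      (mul_pos (h₁.pos y hy) (h₂.pos y hy))
  have hx' := Ioo_subset_Icc_self hx
  have hNx : 0 < N x := by
    rcases le_or_gt 0 (K x) with hKx | hKx
    · have hmono : StrictMonoOn N (Icc 0 x) := by
        refine strictMonoOn_of_deriv_pos (convex_Icc _ _)
          (hNc.mono (Icc_subset_Icc le_rfl hx.2.le)) fun y hy => ?_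
        rw [interior_Icc] at hy
        have hy' : y ∈ Icc (0 : ℝ) 1 := ⟨hy.1.le, hy.2.le.trans hx.2.le⟩
        rw [(hd y hy').deriv]
        exact mul_pos (hfac y ⟨hy.1.le, hy.2.trans hx.2⟩)
          (hKx.trans_lt (hKanti hy' hx' hy.2))
      have := hmono ⟨le_rfl, hx.1.le⟩ ⟨hx.1.le, le_rfl⟩ hx.1
      linarith
    · have hanti : StrictAntiOn N (Icc x 1) := by
        refine strictAntiOn_of_deriv_neg (convex_Icc _ _)
          (hNc.mono (Icc_subset_Icc hx.1.le le_rfl)) fun y hy => ?_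
        rw [interior_Icc] at hy
        have hy' : y ∈ Icc (0 : ℝ) 1 := ⟨hx.1.le.trans hy.1.le, hy.2.le⟩
        rw [(hd y hy').deriv]
        exact mul_neg_of_pos_of_neg (hfac y ⟨hy'.1, hy.2⟩) ((hKanti hx' hy' hy.1).trans hKx)
      have := hanti ⟨le_rfl, hx.2.le⟩ ⟨hx.2.le, le_rfl⟩ hx.2
      linarith
  exact (pos_iff_pos_of_mul_pos hNx).1 (Real.sqrt_pos.2 (hcc x hx'))

lemma tendsto_div_of_hasDerivAt {f g : ℝ → ℝ} {f' g' c : ℝ} (hf : HasDerivAt f f' c)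
    (hg : HasDerivAt g g' c) (hfc : f c = 0) (hgc : g c = 0) (hg' : g' ≠ 0) :
    Filter.Tendsto (fun x => f x / g x) (nhdsWithin c (Iio c)) (nhds (f' / g')) := by
  have h := (hf.tendsto_slope.div hg.tendsto_slope hg').mono_left
    (nhdsWithin_mono c fun x (hx : x < c) => hx.ne)
  refine h.congr' ?_
  filter_upwards [self_mem_nhdsWithin] with x hx
  have hx' : x - c ≠ 0 := sub_ne_zero.2 (ne_of_lt hx)
  simp only [Pi.div_apply, slope_def_field, hfc, hgc, sub_zero]
  exact div_div_div_cancel_right₀ hx' _ _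

theorem scaled_gap_lt {a b L₁ L₂ M₁ M₂ : ℝ} (ha0 : 0 < a) (hab : a < b) (hb : b < π / 2)
    {u₁ d₁ u₂ d₂ v₁ e₁ v₂ e₂ : ℝ → ℝ} (hu₁ : IsGroundState a L₁ u₁ d₁)
    (hu₂ : IsGroundState b L₂ u₂ d₂) (hv₁ : IsExcitedState a M₁ v₁ e₁)
    (hv₂ : IsExcitedState b M₂ v₂ e₂) : M₂ - L₂ < M₁ - L₁ := by
  have hb0 : 0 < b := ha0.trans hab
  have ha : a < π / 2 := hab.trans hb
  by_contra! hge
  set W₁ : ℝ → ℝ := fun y => e₁ y * u₁ y - v₁ y * d₁ y with hW₁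
  set W₂ : ℝ → ℝ := fun y => e₂ y * u₂ y - v₂ y * d₂ y with hW₂
  set E : ℝ → ℝ := fun y => cos (b * y) * (u₁ y * v₁ y * W₂ y - u₂ y * v₂ y * W₁ y) / u₁ y ^ 2
    with hE
  have hd : ∀ y ∈ Ico (0 : ℝ) 1, HasDerivAt E (cos (b * y) * v₂ y / u₁ y ^ 3 *
      ((M₁ - L₁ - (M₂ - L₂)) * (u₂ y * v₁ y * u₁ y ^ 2) -
        2 * (u₁ y * d₂ y - u₂ y * d₁ y - u₁ y * u₂ y * (drift b y - drift a y) / 2) * W₁ y)) y := by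
    intro y hy
    have hy' := Ico_subset_Icc_self hy
    have hu0 := (hu₁.pos y hy).ne'
    have hw := hasDerivAt_cos_mul (cos_mul_pos hb0 hb hy').ne'
    have hw1 := hasDerivAt_wronskian (hu₁.solves y hy') (hv₁.solves y hy')
    have hw2 := hasDerivAt_wronskian (hu₂.solves y hy') (hv₂.solves y hy')
    have hu1 := (hu₁.solves y hy').1
    have hu2 := (hu₂.solves y hy').1
    have hv1 := (hv₁.solves y hy').1
    have hv2 := (hv₂.solves y hy').1
    refine ((hw.mul (((hu1.mul hv1).mul hw2).sub ((hu2.mul hv2).mul hw1))).div (hu1.pow 2)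
      (pow_ne_zero 2 hu0)).congr_deriv ?_
    simp only [hW₁, Pi.mul_apply, Pi.sub_apply, Pi.pow_apply]
    push_cast
    field_simp
    ring
  have hanti : StrictAntiOn E (Ico 0 1) := by
    refine strictAntiOn_of_deriv_neg (convex_Ico _ _)
      (fun y hy => (hd y hy).continuousAt.continuousWithinAt) fun y hy => ?_
    rw [interior_Ico] at hy
    have hy' := Ioo_subset_Ico_self hy
    rw [(hd y hy').deriv]
    have hF := hu₁.log_deriv_lt ha0 hab hb hu₂ hy
    have hWp : 0 < W₁ y := hv₁.wronskian_pos ha0 ha hu₁ hy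
    have hc := cos_mul_pos hb0 hb (Ioo_subset_Icc_self hy)
    have p1 := hu₁.pos y hy'
    have p2 := hu₂.pos y hy'
    have p3 := hv₁.pos y hy
    have p4 := hv₂.pos y hy
    have t1 : (M₁ - L₁ - (M₂ - L₂)) * (u₂ y * v₁ y * u₁ y ^ 2) ≤ 0 :=
      mul_nonpos_of_nonpos_of_nonneg (by linarith) (by positivity)
    have t2 := mul_pos hF hWp
    exact mul_neg_of_pos_of_neg (by positivity) (by linarith)
  have hE0 : E 0 = 0 := by simp [hE, hv₁.zero, hv₂.zero]
  have hhalf : E (1 / 2) < 0 := by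
    rw [← hE0]
    exact hanti ⟨le_rfl, one_pos⟩ ⟨by norm_num, by norm_num⟩ (by norm_num)
  have h1mem : (1 : ℝ) ∈ Icc (0 : ℝ) 1 := ⟨zero_le_one, le_rfl⟩
  have hlim : Filter.Tendsto E (nhdsWithin 1 (Iio 1)) (nhds 0) := by
    have r1 := tendsto_div_of_hasDerivAt (hv₁.solves 1 h1mem).1 (hu₁.solves 1 h1mem).1 hv₁.one
      hu₁.one hu₁.deriv_one.ne
    have r2 := tendsto_div_of_hasDerivAt (hu₂.solves 1 h1mem).1 (hu₁.solves 1 h1mem).1 hu₂.one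
      hu₁.one hu₁.deriv_one.ne
    have r3 := tendsto_div_of_hasDerivAt (hv₂.solves 1 h1mem).1 (hu₁.solves 1 h1mem).1 hv₂.one
      hu₁.one hu₁.deriv_one.ne
    have w1 : Filter.Tendsto W₁ (nhdsWithin 1 (Iio 1)) (nhds (W₁ 1)) :=
      (hasDerivAt_wronskian (hu₁.solves 1 h1mem) (hv₁.solves 1 h1mem)).continuousAt.tendsto.mono_left
        nhdsWithin_le_nhds
    have w2 : Filter.Tendsto W₂ (nhdsWithin 1 (Iio 1)) (nhds (W₂ 1)) :=
      (hasDerivAt_wronskian (hu₂.solves 1 h1mem) (hv₂.solves 1 h1mem)).continuousAt.tendsto.mono_left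
        nhdsWithin_le_nhds
    have w1z : W₁ 1 = 0 := by simp [hW₁, hu₁.one, hv₁.one]
    have w2z : W₂ 1 = 0 := by simp [hW₂, hu₂.one, hv₂.one]
    rw [w1z] at w1
    rw [w2z] at w2
    have hc : Filter.Tendsto (fun y => cos (b * y)) (nhdsWithin 1 (Iio 1))
        (nhds (cos (b * 1))) :=
      (Continuous.tendsto (by fun_prop) 1).mono_left nhdsWithin_le_nhds
    have hall := hc.mul ((r1.mul w2).sub ((r2.mul r3).mul w1))
    simp only [mul_zero, sub_zero] at hall
    refine hall.congr' ?_
    filter_upwards [Ioo_mem_nhdsLT (zero_lt_one' ℝ)] with y hy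
    have hu0 := (hu₁.pos y (Ioo_subset_Ico_self hy)).ne'
    simp only [hE]
    field_simp
  have hev : ∀ᶠ y in nhdsWithin (1 : ℝ) (Iio 1), E y ≤ E (1 / 2) := by
    filter_upwards [Ioo_mem_nhdsLT (show (1 / 2 : ℝ) < 1 by norm_num)] with y hy
    have h0 : (0 : ℝ) < y := by linarith [hy.1]
    exact (hanti ⟨by norm_num, by norm_num⟩ ⟨h0.le, hy.2⟩ hy.1).le
  linarith [le_of_tendsto hlim hev]

lemma mul_mem_Icc {a x : ℝ} (ha0 : 0 < a) (hx : x ∈ Icc (0 : ℝ) 1) : a * x ∈ Icc 0 a :=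
  ⟨mul_nonneg ha0.le hx.1, mul_le_of_le_one_right ha0.le hx.2⟩

lemma exists_isGroundState {D : ℝ} (hD0 : 0 < D) (hD : D < π) :
    ∃ u d : ℝ → ℝ, IsGroundState (D / 2) ((D / 2) ^ 2 * modelLam1 2 D) u d := by
  obtain ⟨u, d, hode, hpos, hd0, hu1, hd1⟩ := exists_modelLam1_eigenfunction hD0 hD
  have ha0 : 0 < D / 2 := by linarith
  refine ⟨_, _, fun x hx => (hode _ (mul_mem_Icc ha0 hx)).scale, fun x hx => hpos _ ?_, ?_, ?_, ?_⟩
  · exact ⟨mul_nonneg ha0.le hx.1, mul_lt_of_lt_one_right ha0 hx.2⟩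
  · simp [hd0]
  · simp [hu1]
  · simpa using mul_neg_of_pos_of_neg ha0 hd1

lemma exists_isExcitedState {D : ℝ} (hD0 : 0 < D) (hD : D < π) :
    ∃ v e : ℝ → ℝ, IsExcitedState (D / 2) ((D / 2) ^ 2 * modelLam2 2 D) v e := by
  obtain ⟨v, e, hode, hpos, hv0, he0, hv1⟩ := exists_modelLam2_eigenfunction hD0 hD
  have ha0 : 0 < D / 2 := by linarith
  refine ⟨_, _, fun x hx => (hode _ (mul_mem_Icc ha0 hx)).scale, fun x hx => hpos _ ?_, ?_, ?_, ?_⟩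
  · exact ⟨mul_pos ha0 hx.1, mul_lt_of_lt_one_right ha0 hx.2⟩
  · simp [hv0]
  · simpa using mul_pos ha0 he0
  · simp [hv1]

/-- For `n = 2`, the normalized model gap `D²·(λ̄₂(2,D) − λ̄₁(2,D))`
is strictly decreasing in `D` on `(0, π)`. -/
theorem model_gap_strictAnti_dim_two (D₁ D₂ : ℝ)
    (h1 : 0 < D₁) (h12 : D₁ < D₂) (h2 : D₂ < π) :
    D₁ ^ 2 * (modelLam2 2 D₁ - modelLam1 2 D₁) > D₂ ^ 2 * (modelLam2 2 D₂ - modelLam1 2 D₂) := by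
  obtain ⟨u₁, d₁, hu₁⟩ := exists_isGroundState h1 (h12.trans h2)
  obtain ⟨u₂, d₂, hu₂⟩ := exists_isGroundState (h1.trans h12) h2
  obtain ⟨v₁, e₁, hv₁⟩ := exists_isExcitedState h1 (h12.trans h2)
  obtain ⟨v₂, e₂, hv₂⟩ := exists_isExcitedState (h1.trans h12) h2
  have key := scaled_gap_lt (by linarith) (by linarith) (by linarith) hu₁ hu₂ hv₁ hv₂
  linarith
end
end
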